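/- arXiv:2009.04921 — 3 statements merged into one kernel-verified Lean document; each statement's English description precedes it below -/
import Mathlib

section
/- Let m ∈ ℕ, r₀ ≥ 0, E ⊂ ℝᵐ, and let (r_k)_{k∈ℕ} be an unbounded increasing sequence of positive real numbers with r₁ > r₀ and limsup_{k→∞} r_{k+1}/r_k < +∞, such that each set E_k := E ∩ S(0, r_k) is measurable with respect to the surface measure σ_{r_k} on the sphere S(0, r_k) and lim_{k→∞} σ_{r_k}(E_k)/r_k^{m-1} = 0. Then for every subharmonic function v on ℝᵐ \ B̄(0, r₀) of finite order one has sup_{ℝᵐ \ B̄(0,r₀)} v = max{M_E, M₀}, where M_E := sup_{(ℝᵐ \ B̄(0,r₀)) \ E} v and M₀ := sup_{B̄(0,r₁) \ B̄(0,r₀)} v. -/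
open MeasureTheory Metric Filter Set
open scoped ENNReal NNReal Topology

noncomputable section

/-- `ℝᵐ` as the Euclidean space `EuclideanSpace ℝ (Fin m)`. -/
abbrev Em (m : ℕ) := EuclideanSpace ℝ (Fin m)

/-- The positive-part valued `ℝ≥0∞` of an extended real. -/
def EReal.toENNReal' (x : EReal) : ℝ≥0∞ :=
  if x = ⊤ then ⊤ else ENNReal.ofReal x.toReal

/-- Integral of an `EReal`-valued function: difference of the lower integrals of
the positive and the negative parts. -/
def eIntegral {α : Type*} [MeasurableSpace α] (μ : Measure α) (f : α → EReal) : EReal :=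
  ((∫⁻ x, (f x).toENNReal' ∂μ : ℝ≥0∞) : EReal) - ((∫⁻ x, (-(f x)).toENNReal' ∂μ : ℝ≥0∞) : EReal)

/-- Integrability of an `EReal`-valued function. -/
def EIntegrable {α : Type*} [MeasurableSpace α] (μ : Measure α) (f : α → EReal) : Prop :=
  Measurable f ∧ (∫⁻ x, (f x).toENNReal' ∂μ) < ⊤ ∧ (∫⁻ x, (-(f x)).toENNReal' ∂μ) < ⊤

/-- Surface (area) measure on the sphere of radius `t` centered at `x` in `ℝᵐ`:
the `(m-1)`-dimensional Hausdorff measure restricted to the sphere. -/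
def sphereMeasure (m : ℕ) (x : Em m) (t : ℝ) : Measure (Em m) :=
  (μH[(m : ℝ) - 1]).restrict (Metric.sphere x t)

/-- `s_{m-1}`: the surface area of the unit sphere in `ℝᵐ`. -/
def sphereArea (m : ℕ) : ℝ :=
  (μH[(m : ℝ) - 1] (Metric.sphere (0 : Em m) 1)).toReal

/-- `b_m`: the volume of the unit ball in `ℝᵐ`. -/
def ballVolume (m : ℕ) : ℝ :=
  (volume (Metric.closedBall (0 : Em m) 1)).toReal

/-- Mean of an `EReal`-valued function over the sphere `S(x,t) ⊂ ℝᵐ`. -/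
def sMean (m : ℕ) (v : Em m → EReal) (x : Em m) (t : ℝ) : EReal :=
  ((1 / (sphereArea m * t ^ (m - 1)) : ℝ) : EReal) * eIntegral (sphereMeasure m x t) v

/-- Mean of an `EReal`-valued function over the closed ball `B̄(x,t) ⊂ ℝᵐ`. -/
def bMean (m : ℕ) (v : Em m → EReal) (x : Em m) (t : ℝ) : EReal :=
  ((1 / (ballVolume m * t ^ m) : ℝ) : EReal) *
    eIntegral (volume.restrict (Metric.closedBall x t)) v

/-- A function is subharmonic on a set `U ⊆ ℝᵐ`: it is upper semicontinuous on `U`,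
takes values in `[-∞, +∞)` on `U`, and satisfies the sub-mean inequality over every
sphere whose corresponding closed ball lies in `U`. -/
def SubharmonicOn (m : ℕ) (v : Em m → EReal) (U : Set (Em m)) : Prop :=
  UpperSemicontinuousOn v U ∧ (∀ x ∈ U, v x ≠ ⊤) ∧
    ∀ x ∈ U, ∀ t : ℝ, 0 < t → Metric.closedBall x t ⊆ U → v x ≤ sMean m v x t

/-- The order (at `∞`) of an `EReal`-valued function on a normed space:
`limsup_{|x|→∞} ln(1 + v⁺(x)) / ln |x|`. -/
def ordE {V : Type*} [NormedAddCommGroup V] (v : V → EReal) : EReal :=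
  Filter.limsup
    (fun x => ((Real.log (1 + max (v x).toReal 0) / Real.log ‖x‖ : ℝ) : EReal))
    (Bornology.cobounded V)

/-- The order (at `∞`) of a real-valued function on a normed space. -/
def ordR {V : Type*} [NormedAddCommGroup V] (v : V → ℝ) : EReal :=
  Filter.limsup
    (fun x => ((Real.log (1 + max (v x) 0) / Real.log ‖x‖ : ℝ) : EReal))
    (Bornology.cobounded V)

theorem hausdorffMeasure_sphere_lt_top (n : ℕ) :
    μH[(n : ℝ)] (Metric.sphere (0 : Em (n + 1)) 1) < ⊤ := by
  classical
  let w : Fin (n + 1) → ℝ → (Fin n → ℝ) → Em (n + 1) :=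
    fun i s y => WithLp.toLp 2 (i.insertNth (α := fun _ => ℝ) s y)
  have hwi : ∀ i s y, w i s y i = s := by intro i s y; simp [w]
  have hwc : ∀ i s, ContDiff ℝ 1 (w i s) := by
    intro i s
    rw [contDiff_euclidean]
    intro j
    refine Fin.succAboveCases i ?_ (fun k => ?_) j
    · simp only [hwi]; exact contDiff_const
    · simp only [w, Fin.insertNth_apply_succAbove]; fun_prop
  have hw0 : ∀ i s y, s ≠ 0 → w i s y ≠ 0 := by
    intro i s y hs h
    apply hs
    rw [← hwi i s y, h]; rfl
  have hF : ∀ i s, s ≠ 0 →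
      μH[(n : ℝ)] ((fun y => ‖w i s y‖⁻¹ • w i s y) '' Icc (-1) 1) < ⊤ := by
    intro i s hs
    have hc : ContDiff ℝ 1 (fun y => ‖w i s y‖⁻¹ • w i s y) := by
      refine ContDiff.smul (ContDiff.inv ((hwc i s).norm ℝ (fun y => hw0 i s y hs)) ?_) (hwc i s)
      intro y; exact norm_ne_zero_iff.2 (hw0 i s y hs)
    obtain ⟨K, hK⟩ := (hc.locallyLipschitz.locallyLipschitzOn
      (s := Icc (-1) 1)).exists_lipschitzOnWith_of_compact isCompact_Icc
    refine (hK.hausdorffMeasure_image_le (Nat.cast_nonneg n)).trans_lt ?_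
    have h2 : (μH[(n : ℝ)] : Measure (Fin n → ℝ)) = volume := by
      have := hausdorffMeasure_pi_real (ι := Fin n)
      rwa [Fintype.card_fin] at this
    rw [h2]
    exact ENNReal.mul_lt_top (by simp) isCompact_Icc.measure_lt_top
  have hcov : Metric.sphere (0 : Em (n + 1)) 1 ⊆ ⋃ i : Fin (n + 1),
      (((fun y => ‖w i 1 y‖⁻¹ • w i 1 y) '' Icc (-1) 1) ∪
      ((fun y => ‖w i (-1) y‖⁻¹ • w i (-1) y) '' Icc (-1) 1)) := by
    intro x hx
    rw [mem_sphere_zero_iff_norm] at hx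
    obtain ⟨i, -, hi⟩ := Finset.exists_max_image Finset.univ (fun i => |x i|) ⟨0, by simp⟩
    have hxi : 0 < |x i| := by
      rw [abs_pos]
      intro h0
      have : x = 0 := by
        ext j
        have := hi j (Finset.mem_univ _)
        rw [h0, abs_zero] at this
        simpa using this
      rw [this] at hx; simp at hx
    have key : ∀ s : ℝ, s * |x i| = x i →
        x ∈ (fun y => ‖w i s y‖⁻¹ • w i s y) '' Icc (-1) 1 := by
      intro s hs
      refine ⟨fun j => x (i.succAbove j) / |x i|, ⟨fun j => ?_, fun j => ?_⟩, ?_⟩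
      · have := hi (i.succAbove j) (Finset.mem_univ _)
        simp only [Pi.neg_apply, Pi.one_apply]
        rw [le_div_iff₀ hxi]
        linarith [neg_abs_le (x (i.succAbove j))]
      · have := hi (i.succAbove j) (Finset.mem_univ _)
        simp only [Pi.one_apply]
        rw [div_le_iff₀ hxi]
        linarith [le_abs_self (x (i.succAbove j))]
      · have hwx : w i s (fun j => x (i.succAbove j) / |x i|) = |x i|⁻¹ • x := by
          ext j
          refine Fin.succAboveCases i ?_ (fun k => ?_) j
          · rw [hwi]
            simp only [PiLp.smul_apply, smul_eq_mul]
            nth_rewrite 2 [← hs]; field_simp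
          · simp [w]; field_simp
        simp only [hwx, norm_smul, hx]
        simp only [norm_inv, Real.norm_eq_abs, abs_abs, mul_one, inv_inv, smul_smul]
        rw [mul_inv_cancel₀ hxi.ne', one_smul]
    rw [mem_iUnion]
    refine ⟨i, ?_⟩
    rcases le_total 0 (x i) with h | h
    · left; exact key 1 (by rw [abs_of_nonneg h, one_mul])
    · right; exact key (-1) (by rw [abs_of_nonpos h]; ring)
  refine (measure_mono hcov).trans_lt ?_
  refine (measure_iUnion_le _).trans_lt ?_
  rw [tsum_fintype]
  refine ENNReal.sum_lt_top.2 fun i _ => ?_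
  exact (measure_union_le _ _).trans_lt
    (ENNReal.add_lt_top.2 ⟨hF i 1 one_ne_zero, hF i (-1) (by norm_num)⟩)

theorem hausdorffMeasure_sphere_pos (n : ℕ) :
    0 < μH[(n : ℝ)] (Metric.sphere (0 : Em (n + 1)) 1) := by
  let G : Em (n + 1) → (Fin n → ℝ) := fun x j => x j.succ
  have hG : LipschitzWith 1 G := by
    refine LipschitzWith.of_dist_le_mul fun x y => ?_
    rw [NNReal.coe_one, one_mul, dist_pi_le_iff dist_nonneg]
    intro j
    rw [dist_eq_norm, dist_eq_norm]
    exact PiLp.norm_apply_le (x - y) j.succ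
  have hsub : Metric.ball (0 : Fin n → ℝ) (1 / (n + 1)) ⊆ G '' Metric.sphere (0 : Em (n + 1)) 1 := by
    intro y hy
    rw [mem_ball_zero_iff] at hy
    have hs : ∑ j, y j ^ 2 ≤ 1 := by
      calc ∑ j, y j ^ 2 ≤ ∑ _j : Fin n, (1 / (n + 1 : ℝ)) := by
            refine Finset.sum_le_sum fun j _ => ?_
            have h1 : |y j| ≤ 1 / (n + 1) := (norm_le_pi_norm y j).trans hy.le
            have h2 : (1 : ℝ) / (n + 1) ≤ 1 := by
              rw [div_le_one (by positivity)]; linarith [Nat.cast_nonneg (α := ℝ) n]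
            rw [← sq_abs]
            nlinarith [abs_nonneg (y j)]
        _ ≤ 1 := by
            simp only [Finset.sum_const, Finset.card_univ, Fintype.card_fin, nsmul_eq_mul]
            rw [mul_one_div, div_le_one (by positivity)]; linarith
    refine ⟨WithLp.toLp 2 (Fin.cons (√(1 - ∑ j, y j ^ 2)) y), ?_, ?_⟩
    · rw [mem_sphere_zero_iff_norm, EuclideanSpace.norm_eq, Fin.sum_univ_succ]
      simp [Real.sq_sqrt (sub_nonneg.2 hs)]
    · ext j; simp [G]
  have h2 : (μH[(n : ℝ)] : Measure (Fin n → ℝ)) = volume := by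
    have := hausdorffMeasure_pi_real (ι := Fin n)
    rwa [Fintype.card_fin] at this
  have h3 := hG.hausdorffMeasure_image_le (Nat.cast_nonneg n) (Metric.sphere (0 : Em (n + 1)) 1)
  simp only [ENNReal.coe_one, ENNReal.one_rpow, one_mul] at h3
  refine lt_of_lt_of_le ?_ ((measure_mono hsub).trans h3)
  rw [h2]
  exact Metric.measure_ball_pos _ _ (by positivity)

theorem cast_succ_sub_one (n : ℕ) : ((n + 1 : ℕ) : ℝ) - 1 = n := by
  push_cast; ring

theorem sphereArea_pos (n : ℕ) : 0 < sphereArea (n + 1) := by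
  rw [sphereArea, cast_succ_sub_one]
  exact ENNReal.toReal_pos (hausdorffMeasure_sphere_pos n).ne' (hausdorffMeasure_sphere_lt_top n).ne

open scoped Pointwise in
theorem sphereMeasure_univ (n : ℕ) {t : ℝ} (ht : 0 < t) :
    sphereMeasure (n + 1) 0 t univ = ENNReal.ofReal (sphereArea (n + 1) * t ^ n) := by
  have h1 : Metric.sphere (0 : Em (n + 1)) t = t • Metric.sphere (0 : Em (n + 1)) 1 := by
    rw [_root_.smul_sphere t 0 zero_le_one, smul_zero, Real.norm_eq_abs, abs_of_pos ht, mul_one]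
  rw [sphereMeasure, Measure.restrict_apply_univ, sphereArea, cast_succ_sub_one, h1,
    Measure.hausdorffMeasure_smul₀ (Nat.cast_nonneg n) ht.ne', mul_comm,
    ENNReal.ofReal_mul (by positivity), ENNReal.ofReal_toReal (hausdorffMeasure_sphere_lt_top n).ne]
  rw [ENNReal.smul_def, smul_eq_mul]
  congr 1
  rw [NNReal.rpow_natCast, ENNReal.ofReal, Real.toNNReal_pow ht.le]
  congr 2
  ext
  simp [abs_of_pos ht, ht.le]

theorem measurePreserving_sphereMeasure_linearIsometryEquiv {m : ℕ} (e : Em m ≃ₗᵢ[ℝ] Em m)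
    (t : ℝ) : MeasurePreserving e (sphereMeasure m 0 t) (sphereMeasure m 0 t) := by
  have h := (e.toIsometryEquiv.measurePreserving_hausdorffMeasure ((m : ℝ) - 1)).restrict_preimage
    (s := Metric.sphere (0 : Em m) t) Metric.isClosed_sphere.measurableSet
  have h2 : e.toIsometryEquiv ⁻¹' Metric.sphere (0 : Em m) t = Metric.sphere (0 : Em m) t := by
    ext x; simp
  rw [h2] at h
  exact h

theorem measurePreserving_sphereMeasure_add {m : ℕ} (x : Em m) (t : ℝ) :
    MeasurePreserving (fun y => x + y) (sphereMeasure m 0 t) (sphereMeasure m x t) := by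
  have h := ((IsometryEquiv.addLeft x).measurePreserving_hausdorffMeasure
    ((m : ℝ) - 1)).restrict_preimage (s := Metric.sphere x t) Metric.isClosed_sphere.measurableSet
  have h2 : (IsometryEquiv.addLeft x) ⁻¹' Metric.sphere x t = Metric.sphere (0 : Em m) t := by
    ext y; simp
  rw [h2] at h
  exact h

theorem integrable_sphereMeasure_zero (n : ℕ) {t : ℝ} (ht : 0 < t) {g : Em (n + 1) → ℝ}
    (hg : Continuous g) : Integrable g (sphereMeasure (n + 1) 0 t) := by
  have hfin : IsFiniteMeasure (sphereMeasure (n + 1) 0 t) :=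
    ⟨by rw [sphereMeasure_univ n ht]; exact ENNReal.ofReal_lt_top⟩
  obtain ⟨C, hC⟩ := (isCompact_sphere (0 : Em (n + 1)) t).exists_bound_of_continuousOn
    hg.continuousOn
  refine Integrable.of_bound hg.aestronglyMeasurable C ?_
  rw [sphereMeasure]
  filter_upwards [ae_restrict_mem Metric.isClosed_sphere.measurableSet] with x hx using hC x hx

theorem integral_sphereMeasure_congr {m : ℕ} {t : ℝ} {f g : Em m → ℝ}
    (h : ∀ y, ‖y‖ = t → f y = g y) :
    ∫ y, f y ∂sphereMeasure m 0 t = ∫ y, g y ∂sphereMeasure m 0 t :=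
  setIntegral_congr_fun Metric.isClosed_sphere.measurableSet
    fun y hy => h y (mem_sphere_zero_iff_norm.1 hy)

theorem integral_sphereMeasure_const (n : ℕ) {t : ℝ} (ht : 0 < t) (c : ℝ) :
    ∫ _y, c ∂sphereMeasure (n + 1) 0 t = sphereArea (n + 1) * t ^ n * c := by
  rw [integral_const, Measure.real, sphereMeasure_univ n ht, ENNReal.toReal_ofReal, smul_eq_mul]
  have := sphereArea_pos n
  positivity

theorem integral_sphereMeasure_inner {m : ℕ} (t : ℝ) (a : Em m) :
    ∫ y, inner ℝ a y ∂sphereMeasure m 0 t = 0 := by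
  have h := (measurePreserving_sphereMeasure_linearIsometryEquiv (LinearIsometryEquiv.neg ℝ)
    t).integral_comp (LinearIsometryEquiv.neg ℝ (E := Em m)).toHomeomorph.measurableEmbedding
    (fun y => inner ℝ a y)
  simp only [LinearIsometryEquiv.coe_neg, inner_neg_right, integral_neg] at h
  linarith

theorem integral_sphereMeasure_inner_sq_eq {m : ℕ} (t : ℝ) {a b : Em m} (hab : ‖a‖ = ‖b‖) :
    ∫ y, (inner ℝ a y) ^ 2 ∂sphereMeasure m 0 t = ∫ y, (inner ℝ b y) ^ 2 ∂sphereMeasure m 0 t := by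
  set e := (ℝ ∙ (a - b))ᗮ.reflection with he
  have hb : e a = b := Submodule.reflection_sub hab
  have h := (measurePreserving_sphereMeasure_linearIsometryEquiv e t).integral_comp
    e.toHomeomorph.measurableEmbedding (fun y => (inner ℝ b y) ^ 2)
  rw [← h]
  congr 1
  ext y
  rw [← hb, LinearIsometryEquiv.inner_map_map]

theorem integral_sphereMeasure_inner_sq (n : ℕ) {t : ℝ} (ht : 0 < t) (a : Em (n + 1)) :
    ∫ y, (inner ℝ a y) ^ 2 ∂sphereMeasure (n + 1) 0 t =
      sphereArea (n + 1) * t ^ n * (t ^ 2 * ‖a‖ ^ 2 / (n + 1)) := by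
  have h1 : ∀ i : Fin (n + 1), ∫ y, (inner ℝ a y) ^ 2 ∂sphereMeasure (n + 1) 0 t =
      ‖a‖ ^ 2 * ∫ y, (y i) ^ 2 ∂sphereMeasure (n + 1) 0 t := by
    intro i
    rw [integral_sphereMeasure_inner_sq_eq t (b := ‖a‖ • EuclideanSpace.single i (1 : ℝ))
      (by simp [norm_smul]), ← integral_const_mul]
    congr 1
    ext y
    rw [inner_smul_left, EuclideanSpace.inner_single_left]
    simp [mul_pow]
  have h2 : ∑ i : Fin (n + 1), ∫ y, (y i) ^ 2 ∂sphereMeasure (n + 1) 0 t =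
      sphereArea (n + 1) * t ^ n * t ^ 2 := by
    rw [← integral_finsetSum _ fun i _ => integrable_sphereMeasure_zero n ht (by fun_prop),
      ← integral_sphereMeasure_const n ht]
    refine integral_sphereMeasure_congr fun y hy => ?_
    rw [← hy, EuclideanSpace.norm_sq_eq]
    simp
  have h3 : (n + 1 : ℝ) * ∫ y, (inner ℝ a y) ^ 2 ∂sphereMeasure (n + 1) 0 t =
      ‖a‖ ^ 2 * (sphereArea (n + 1) * t ^ n * t ^ 2) := by
    rw [← h2, Finset.mul_sum, ← Finset.sum_congr rfl fun i _ => h1 i]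
    simp
  have : (n + 1 : ℝ) ≠ 0 := by positivity
  field_simp
  linarith

theorem integral_sphereMeasure_inner_mul_inner (n : ℕ) {t : ℝ} (ht : 0 < t) (a b : Em (n + 1)) :
    ∫ y, inner ℝ a y * inner ℝ b y ∂sphereMeasure (n + 1) 0 t =
      sphereArea (n + 1) * t ^ n * (t ^ 2 * inner ℝ a b / (n + 1)) := by
  have h : ∀ y, inner ℝ a y * inner ℝ b y =
      (1 / 4) * ((inner ℝ (a + b) y) ^ 2 - (inner ℝ (a - b) y) ^ 2) := by
    intro y; rw [inner_add_left, inner_sub_left]; ring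
  simp_rw [h]
  rw [integral_const_mul, integral_sub (integrable_sphereMeasure_zero n ht (by fun_prop))
    (integrable_sphereMeasure_zero n ht (by fun_prop)), integral_sphereMeasure_inner_sq n ht,
    integral_sphereMeasure_inner_sq n ht, norm_add_sq_real, norm_sub_sq_real]
  ring

theorem EReal.toENNReal'_mono {x y : EReal} (h : x ≤ y) : x.toENNReal' ≤ y.toENNReal' := by
  unfold EReal.toENNReal'
  split_ifs with hx hy hy
  · exact le_rfl
  · exact absurd (top_le_iff.1 (hx ▸ h)) hy
  · exact le_top
  · by_cases hb : x = ⊥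
    · simp [hb]
    · exact ENNReal.ofReal_le_ofReal (EReal.toReal_le_toReal h hb hy)

theorem eIntegral_coe {α : Type*} [MeasurableSpace α] {μ : Measure α} {g : α → ℝ}
    (hg : Integrable g μ) : eIntegral μ (fun x => (g x : EReal)) = ((∫ x, g x ∂μ : ℝ) : EReal) := by
  have h1 : ∀ x : ℝ, (x : EReal).toENNReal' = ENNReal.ofReal x := by
    intro x; simp [EReal.toENNReal']
  have h2 : ∀ x : ℝ, (-(x : EReal)).toENNReal' = ENNReal.ofReal (-x) := by
    intro x; rw [← EReal.coe_neg, h1]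
  rw [eIntegral, integral_eq_lintegral_pos_part_sub_lintegral_neg_part hg]
  simp only [h1, h2]
  rw [EReal.coe_sub, EReal.coe_ennreal_toReal, EReal.coe_ennreal_toReal]
  · exact hg.neg.lintegral_lt_top.ne
  · exact hg.lintegral_lt_top.ne

/-- A continuous majorant on a sphere bounds the spherical mean. -/
theorem sMean_le_of_le (n : ℕ) {v : Em (n + 1) → EReal} {x : Em (n + 1)} {t : ℝ} (ht : 0 < t)
    {g : Em (n + 1) → ℝ} (hg : Continuous g) (hvg : ∀ y, ‖y‖ = t → v (x + y) ≤ g y) :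
    sMean (n + 1) v x t ≤
      ((1 / (sphereArea (n + 1) * t ^ n) * ∫ y, g y ∂sphereMeasure (n + 1) 0 t : ℝ) : EReal) := by
  have hA := sphereArea_pos n
  have hmp := measurePreserving_sphereMeasure_add x t
  have hemb : MeasurableEmbedding (fun y : Em (n + 1) => x + y) :=
    (Homeomorph.addLeft x).measurableEmbedding
  rw [sMean, EReal.coe_mul, Nat.add_sub_cancel]
  refine mul_le_mul_of_nonneg_left ?_ (EReal.coe_nonneg.2 (by positivity))
  rw [← eIntegral_coe (integrable_sphereMeasure_zero n ht hg)]
  rw [eIntegral, eIntegral, ← hmp.lintegral_comp_emb hemb, ← hmp.lintegral_comp_emb hemb]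
  refine EReal.sub_le_sub ?_ ?_
  · refine EReal.coe_ennreal_le_coe_ennreal_iff.2
      (setLIntegral_mono' Metric.isClosed_sphere.measurableSet fun y hy => ?_)
    exact EReal.toENNReal'_mono (hvg y (mem_sphere_zero_iff_norm.1 hy))
  · refine EReal.coe_ennreal_le_coe_ennreal_iff.2
      (setLIntegral_mono' Metric.isClosed_sphere.measurableSet fun y hy => ?_)
    exact EReal.toENNReal'_mono (EReal.neg_le_neg_iff.2 (hvg y (mem_sphere_zero_iff_norm.1 hy)))

/-- The spherical means of `h` about `x` behave like `h x + l * t ^ 2 + o(t ^ 2)`, in the strong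
sense that `h` is approximated near `x` up to `o(‖y‖ ^ 2)` by a continuous function `q` whose
spherical means are `h x + l * t ^ 2`. -/
def HasMeanExpansion (n : ℕ) (h : Em (n + 1) → ℝ) (x : Em (n + 1)) (l : ℝ) : Prop :=
  ∃ q : Em (n + 1) → ℝ, Continuous q ∧
    (∀ t : ℝ, 0 < t → ∫ y, q y ∂sphereMeasure (n + 1) 0 t =
      sphereArea (n + 1) * t ^ n * (h x + l * t ^ 2)) ∧
    (fun y => h (x + y) - q y) =o[𝓝 0] fun y => ‖y‖ ^ 2

namespace HasMeanExpansion

variable {n : ℕ} {x : Em (n + 1)}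

theorem add {h₁ h₂ : Em (n + 1) → ℝ} {l₁ l₂ : ℝ} (H₁ : HasMeanExpansion n h₁ x l₁)
    (H₂ : HasMeanExpansion n h₂ x l₂) : HasMeanExpansion n (fun y => h₁ y + h₂ y) x (l₁ + l₂) := by
  obtain ⟨q₁, hc₁, hi₁, ho₁⟩ := H₁
  obtain ⟨q₂, hc₂, hi₂, ho₂⟩ := H₂
  refine ⟨fun y => q₁ y + q₂ y, hc₁.add hc₂, fun t ht => ?_, ?_⟩
  · rw [integral_add (integrable_sphereMeasure_zero n ht hc₁)
      (integrable_sphereMeasure_zero n ht hc₂), hi₁ t ht, hi₂ t ht]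
    ring
  · refine (ho₁.add ho₂).congr_left fun y => ?_
    ring

theorem const_mul {h : Em (n + 1) → ℝ} {l : ℝ} (c : ℝ) (H : HasMeanExpansion n h x l) :
    HasMeanExpansion n (fun y => c * h y) x (c * l) := by
  obtain ⟨q, hc, hi, ho⟩ := H
  refine ⟨fun y => c * q y, hc.const_mul c, fun t ht => ?_, ?_⟩
  · rw [integral_const_mul, hi t ht]
    ring
  · refine (ho.const_mul_left c).congr_left fun y => ?_
    ring

theorem of_quadratic {h : Em (n + 1) → ℝ} (a α : ℝ) (b c d : Em (n + 1)) (ha : h x = a)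
    (ho : (fun y => h (x + y) - (a + inner ℝ d y + α * ‖y‖ ^ 2 + inner ℝ b y * inner ℝ c y))
      =o[𝓝 0] fun y => ‖y‖ ^ 2) :
    HasMeanExpansion n h x (α + inner ℝ b c / (n + 1)) := by
  refine ⟨_, by fun_prop, fun t ht => ?_, ho⟩
  rw [integral_add (integrable_sphereMeasure_zero n ht (by fun_prop))
      (integrable_sphereMeasure_zero n ht (by fun_prop)),
    integral_add (integrable_sphereMeasure_zero n ht (by fun_prop))
      (integrable_sphereMeasure_zero n ht (by fun_prop)),
    integral_add (integrable_sphereMeasure_zero n ht (by fun_prop))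
      (integrable_sphereMeasure_zero n ht (by fun_prop)),
    integral_sphereMeasure_const n ht, integral_sphereMeasure_inner,
    integral_sphereMeasure_inner_mul_inner n ht, integral_sphereMeasure_congr
      (g := fun _ => α * t ^ 2) (fun y hy => by rw [hy]), integral_sphereMeasure_const n ht, ha]
  ring

theorem const_sub_norm_sq (R : ℝ) (x : Em (n + 1)) :
    HasMeanExpansion n (fun y => R - ‖y‖ ^ 2) x (-1) := by
  have h := of_quadratic (h := fun y => R - ‖y‖ ^ 2) (x := x) (R - ‖x‖ ^ 2) (-1) 0 0
    ((-2 : ℝ) • x) rfl ?_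
  · simpa using h
  · refine (Asymptotics.isLittleO_zero _ _).congr_left fun y => ?_
    rw [norm_add_sq_real, real_inner_smul_left]
    simp
    ring

theorem sum {ι : Type*} (s : Finset ι) {h : ι → Em (n + 1) → ℝ}
    (H : ∀ i ∈ s, HasMeanExpansion n (h i) x 0) :
    HasMeanExpansion n (fun y => ∑ i ∈ s, h i y) x 0 := by
  classical
  induction s using Finset.induction_on with
  | empty =>
    refine ⟨fun _ => 0, continuous_const, fun t _ => by simp, ?_⟩
    simp
  | insert i s hi ih =>
    simp only [Finset.sum_insert hi]
    simpa using (H i (Finset.mem_insert_self i s)).add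
      (ih fun j hj => H j (Finset.mem_insert_of_mem hj))

end HasMeanExpansion

/-- The Poisson kernel of a ball centered at `0`, with pole `z` and without normalization. -/
def poissonKernelAt (n : ℕ) (z x : Em (n + 1)) : ℝ :=
  (‖z‖ ^ 2 - ‖x‖ ^ 2) * (‖x - z‖ ^ 2) ^ (-((n + 1 : ℝ) / 2))

theorem rpow_add_taylor_two {b : ℝ} (hb : 0 < b) (β : ℝ) :
    (fun s : ℝ => (b + s) ^ β - (b ^ β + β * b ^ (β - 1) * s +
      β * (β - 1) / 2 * b ^ (β - 2) * s ^ 2)) =o[𝓝 0] fun s => s ^ 2 := by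
  have hd : ∀ γ s : ℝ, -b < s → HasDerivAt (fun s : ℝ => (b + s) ^ γ) (γ * (b + s) ^ (γ - 1)) s := by
    intro γ s hs
    have := (((hasDerivAt_id s).const_add b).rpow_const (p := γ) (Or.inl (by simp; linarith)))
    simpa using this
  have h1 : (fun s : ℝ => β * (b + s) ^ (β - 1) - (β * b ^ (β - 1) +
      β * (β - 1) * b ^ (β - 2) * s)) =o[𝓝 0] fun s => s := by
    have h := ((hd (β - 1) 0 (by linarith)).const_mul β).isLittleO
    simp only [sub_zero, add_zero, smul_eq_mul] at h
    refine h.congr_left fun s => ?_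
    rw [show β - 1 - 1 = β - 2 by ring]
    ring
  have h2 := Convex.isLittleO_pow_succ_real (s := Ioi (-b)) (x₀ := 0) (n := 1)
    (f := fun s : ℝ => (b + s) ^ β - (b ^ β + β * b ^ (β - 1) * s +
      β * (β - 1) / 2 * b ^ (β - 2) * s ^ 2)) (convex_Ioi _) (by simpa using hb)
    (fun s hs => by
      have := (hd β s hs).sub ((((hasDerivAt_id s).const_mul (β * b ^ (β - 1))).const_add
        (b ^ β)).add ((hasDerivAt_pow 2 s).const_mul (β * (β - 1) / 2 * b ^ (β - 2))))
      refine this.hasDerivWithinAt) (by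
      rw [isOpen_Ioi.nhdsWithin_eq (by simpa using hb)]
      refine (h1.congr_left fun s => ?_).congr_right fun s => ?_
      · push_cast
        ring
      · simp)
  rw [isOpen_Ioi.nhdsWithin_eq (by simpa using hb)] at h2
  simpa using h2

theorem hasMeanExpansion_poissonKernelAt (n : ℕ) {z x : Em (n + 1)} (hxz : x ≠ z) :
    HasMeanExpansion n (poissonKernelAt n z) x 0 := by
  set c := x - z with hc
  set b := ‖c‖ ^ 2 with hb
  have hb0 : 0 < b := by
    have : 0 < ‖c‖ := norm_pos_iff.2 (sub_ne_zero.2 hxz)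
    positivity
  set β : ℝ := -((n + 1 : ℝ) / 2) with hβ
  set a := ‖z‖ ^ 2 - ‖x‖ ^ 2 with ha
  set F0 := b ^ β with hF0
  set F1 := β * b ^ (β - 1) with hF1
  set F2 := β * (β - 1) / 2 * b ^ (β - 2) with hF2
  set s : Em (n + 1) → ℝ := fun y => 2 * inner ℝ c y + ‖y‖ ^ 2 with hs
  have hxy : ∀ y, ‖x + y‖ ^ 2 = ‖x‖ ^ 2 + 2 * inner ℝ x y + ‖y‖ ^ 2 := fun y =>
    norm_add_sq_real x y
  have hcy : ∀ y, ‖x + y - z‖ ^ 2 = b + s y := fun y => by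
    rw [show x + y - z = c + y by rw [hc]; abel, norm_add_sq_real]; simp only [hs]; ring
  have hs0 : Tendsto s (𝓝 0) (𝓝 0) := by
    have : Continuous s := by fun_prop
    simpa [hs] using this.tendsto 0
  have hin : ∀ w : Em (n + 1), (fun y => inner ℝ w y) =O[𝓝 0] fun y : Em (n + 1) => ‖y‖ := by
    intro w
    refine Asymptotics.IsBigO.of_bound ‖w‖ (Eventually.of_forall fun y => ?_)
    simpa using norm_inner_le_norm (𝕜 := ℝ) w y
  have hsO : s =O[𝓝 0] fun y : Em (n + 1) => ‖y‖ := by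
    refine ((hin c).const_mul_left 2).add ?_
    have h1 : (fun y : Em (n + 1) => ‖y‖) =O[𝓝 0] fun _ => (1 : ℝ) :=
      (continuous_norm.tendsto (0 : Em (n + 1))).isBigO_one ℝ
    simpa [sq] using h1.mul (Asymptotics.isBigO_refl (fun y : Em (n + 1) => ‖y‖) (𝓝 0))
  have hs2 : (fun y => s y ^ 2) =O[𝓝 0] fun y : Em (n + 1) => ‖y‖ ^ 2 := hsO.pow 2
  have ho1 : (fun y => (b + s y) ^ β - (F0 + F1 * s y + F2 * s y ^ 2)) =o[𝓝 0]
      fun y : Em (n + 1) => ‖y‖ ^ 2 :=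
    ((rpow_add_taylor_two hb0 β).comp_tendsto hs0).trans_isBigO hs2
  have hN : (fun y : Em (n + 1) => a - 2 * inner ℝ x y - ‖y‖ ^ 2) =O[𝓝 0] fun _ => (1 : ℝ) := by
    have hcont : Continuous (fun y : Em (n + 1) => a - 2 * inner ℝ x y - ‖y‖ ^ 2) := by fun_prop
    exact (hcont.tendsto 0).isBigO_one ℝ
  have ho2 : (fun y => (a - 2 * inner ℝ x y - ‖y‖ ^ 2) *
      ((b + s y) ^ β - (F0 + F1 * s y + F2 * s y ^ 2))) =o[𝓝 0]
      fun y : Em (n + 1) => ‖y‖ ^ 2 := by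
    simpa using hN.mul_isLittleO ho1
  have htend : ∀ f : Em (n + 1) → ℝ, Continuous f → f 0 = 0 →
      f =o[𝓝 0] fun _ : Em (n + 1) => (1 : ℝ) := by
    intro f hf h0
    rw [Asymptotics.isLittleO_one_iff]
    simpa [h0] using hf.tendsto 0
  have ho3 : (fun y => (-2 * inner ℝ x y * F1 - F1 * s y + a * F2 * (4 * inner ℝ c y + ‖y‖ ^ 2)) *
      ‖y‖ ^ 2) =o[𝓝 0] fun y : Em (n + 1) => ‖y‖ ^ 2 := by
    have := (htend (fun y => -2 * inner ℝ x y * F1 - F1 * s y +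
      a * F2 * (4 * inner ℝ c y + ‖y‖ ^ 2)) (by fun_prop) (by simp [hs])).mul_isBigO
      (Asymptotics.isBigO_refl (fun y : Em (n + 1) => ‖y‖ ^ 2) (𝓝 0))
    simpa using this
  have ho4 : (fun y => ((2 * inner ℝ x y + ‖y‖ ^ 2) * F2) * s y ^ 2) =o[𝓝 0]
      fun y : Em (n + 1) => ‖y‖ ^ 2 := by
    have := (htend (fun y => (2 * inner ℝ x y + ‖y‖ ^ 2) * F2) (by fun_prop)
      (by simp)).mul_isBigO hs2
    simpa using this
  have hval : (a * F1 - F0) + inner ℝ c ((4 * a * F2) • c - (4 * F1) • x) / (n + 1) = 0 := by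
    have hF1' : F1 = β * F0 / b := by
      rw [hF1, hF0, Real.rpow_sub_one hb0.ne']; ring
    have hF2' : F2 = β * (β - 1) / 2 * F0 / b ^ 2 := by
      rw [hF2, hF0, show β - 2 = β - 1 - 1 by ring, Real.rpow_sub_one hb0.ne',
        Real.rpow_sub_one hb0.ne']
      field_simp
    have hcx : a + 2 * inner ℝ c x = b := by
      rw [hb, ha, hc, norm_sub_sq_real, inner_sub_left, real_inner_self_eq_norm_sq,
        real_inner_comm z x]
      ring
    have hn : (n + 1 : ℝ) = -2 * β := by rw [hβ]; ring
    have hβ0 : β ≠ 0 := by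
      rw [hβ]; have : (0 : ℝ) < n + 1 := by positivity
      intro h0; linarith
    rw [inner_sub_right, inner_smul_right, inner_smul_right, real_inner_self_eq_norm_sq, ← hb, hn,
      hF1', hF2']
    field_simp
    linear_combination 4 * F0 * hcx
  have hmain := HasMeanExpansion.of_quadratic (h := poissonKernelAt n z) (x := x) (a * F0)
    (a * F1 - F0) c ((4 * a * F2) • c - (4 * F1) • x) ((2 * a * F1) • c - (2 * F0) • x) rfl ?_
  · rwa [hval] at hmain
  · refine ((ho2.add ho3).sub ho4).congr_left fun y => ?_
    rw [poissonKernelAt, hxy, hcy, inner_sub_left ((2 * a * F1) • c),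
      inner_sub_left ((4 * a * F2) • c), real_inner_smul_left, real_inner_smul_left,
      real_inner_smul_left, real_inner_smul_left]
    simp only [hs, ← hβ]
    ring

/-- Maximum principle: a function that is strictly superharmonic to second order cannot be touched
from below by a subharmonic function at an interior point. -/
theorem not_isMaxOn_sub_of_hasMeanExpansion_neg (n : ℕ) {v : Em (n + 1) → EReal}
    {U : Set (Em (n + 1))} (hv : SubharmonicOn (n + 1) v U) {h : Em (n + 1) → ℝ}
    {x : Em (n + 1)} {l : ℝ} (hl : l < 0) (hh : HasMeanExpansion n h x l) {K : Set (Em (n + 1))}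
    (hKU : K ⊆ U) (hK : K ∈ 𝓝 x) (hbot : v x ≠ ⊥) :
    ¬ IsMaxOn (fun y => v y + ((-h y : ℝ) : EReal)) K x := by
  intro hmax
  have hxU : x ∈ U := hKU (mem_of_mem_nhds hK)
  obtain ⟨q, hqc, hqi, hqo⟩ := hh
  lift v x to ℝ using ⟨hv.2.1 x hxU, hbot⟩ with V hV
  have hev : ∀ᶠ y in 𝓝 (0 : Em (n + 1)), h (x + y) ≤ q y + (-l / 2) * ‖y‖ ^ 2 := by
    filter_upwards [hqo.bound (show 0 < -l / 2 by linarith)] with y hy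
    rw [Real.norm_eq_abs, Real.norm_eq_abs, abs_of_nonneg (sq_nonneg ‖y‖)] at hy
    linarith [le_abs_self (h (x + y) - q y)]
  obtain ⟨ε₁, hε₁, hb₁⟩ := Metric.eventually_nhds_iff.1 hev
  obtain ⟨ε₂, hε₂, hb₂⟩ := Metric.mem_nhds_iff.1 hK
  obtain ⟨t, ht0, ht⟩ := exists_between (lt_min hε₁ hε₂)
  have hball : Metric.closedBall x t ⊆ K := fun y hy =>
    hb₂ (lt_of_le_of_lt (mem_closedBall.1 hy) (ht.trans_le (min_le_right _ _)))
  have hle := hv.2.2 x hxU t ht0 (hball.trans hKU)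
  have hmean := sMean_le_of_le n (v := v) (x := x) ht0
    (g := fun y => q y + (-l / 2) * ‖y‖ ^ 2 + (V - h x)) (by fun_prop) (fun y hy => by
      have h1 : v (x + y) + ((-h (x + y) : ℝ) : EReal) ≤ v x + ((-h x : ℝ) : EReal) :=
        hmax (hball (by simp [hy]))
      have h2 := hb₁ (y := y) (by
        rw [dist_zero_right, hy]; exact ht.trans_le (min_le_left _ _))
      rw [← hV, ← EReal.coe_add, EReal.coe_neg] at h1
      have h3 := EReal.sub_le_iff_le_add (Or.inl (EReal.coe_ne_bot _))
        (Or.inl (EReal.coe_ne_top _)) |>.1 h1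
      refine h3.trans ?_
      rw [← EReal.coe_add, EReal.coe_le_coe_iff]
      linarith)
  have hA := sphereArea_pos n
  have hfin := hle.trans hmean
  rw [← hV, EReal.coe_le_coe_iff, integral_add (integrable_sphereMeasure_zero n ht0 (by fun_prop))
      (integrable_sphereMeasure_zero n ht0 (by fun_prop)),
    integral_add (integrable_sphereMeasure_zero n ht0 hqc)
      (integrable_sphereMeasure_zero n ht0 (by fun_prop)),
    hqi t ht0, integral_sphereMeasure_const n ht0, integral_sphereMeasure_congr
      (g := fun _ => (-l / 2) * t ^ 2) (fun y hy => by rw [hy]),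
    integral_sphereMeasure_const n ht0] at hfin
  have hpos : 0 < sphereArea (n + 1) * t ^ n := by positivity
  have : V ≤ V + l / 2 * t ^ 2 := by
    refine hfin.trans_eq ?_
    field_simp
    ring
  nlinarith [sq_pos_of_pos ht0]

theorem le_add_of_hasMeanExpansion_neg (n : ℕ) {v : Em (n + 1) → EReal} {r₀ ρ R M : ℝ}
    (hv : SubharmonicOn (n + 1) v (Metric.closedBall 0 r₀)ᶜ) (hρ : r₀ < ρ)
    {h : Em (n + 1) → ℝ} (hc : ContinuousOn h (Metric.closedBall 0 R))
    (h0 : ∀ x, ‖x‖ ≤ R → 0 ≤ h x)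
    (hexp : ∀ x, ‖x‖ < R → ∃ l < 0, HasMeanExpansion n h x l)
    (hin : ∀ x, r₀ < ‖x‖ → ‖x‖ ≤ ρ → v x ≤ M)
    (hout : ∀ x, ‖x‖ = R → v x ≤ ((M + h x : ℝ) : EReal))
    {x : Em (n + 1)} (hx0 : r₀ < ‖x‖) (hxR : ‖x‖ ≤ R) : v x ≤ ((M + h x : ℝ) : EReal) := by
  by_contra hcon
  rw [not_le] at hcon
  have hMh : ∀ y, ‖y‖ ≤ R → (M : EReal) ≤ ((M + h y : ℝ) : EReal) := fun y hy =>
    EReal.coe_le_coe_iff.2 (by linarith [h0 y hy])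
  have hxρ : ρ ≤ ‖x‖ := by
    by_contra hlt
    exact absurd ((hin x hx0 (not_le.1 hlt).le).trans (hMh x hxR)) (not_le.2 hcon)
  set K : Set (Em (n + 1)) := Metric.closedBall 0 R ∩ {y | ρ ≤ ‖y‖} with hK
  have hKc : IsCompact K :=
    (isCompact_closedBall _ _).inter_right (isClosed_le continuous_const continuous_norm)
  have hKU : K ⊆ (Metric.closedBall 0 r₀)ᶜ := fun y hy => by
    simpa using hρ.trans_le hy.2
  have husc : UpperSemicontinuousOn (fun y => v y + ((-h y : ℝ) : EReal)) K := by
    refine UpperSemicontinuousOn.add' (hv.1.mono hKU) ?_ fun y _ =>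
      EReal.continuousAt_add (Or.inr (EReal.coe_ne_bot _)) (Or.inr (EReal.coe_ne_top _))
    exact (continuous_coe_real_ereal.comp_continuousOn
      (hc.neg.mono inter_subset_left)).upperSemicontinuousOn
  obtain ⟨a, haK, hmax⟩ := UpperSemicontinuousOn.exists_isMaxOn
    (⟨x, by simpa using hxR, hxρ⟩ : K.Nonempty) hKc husc
  have haR : ‖a‖ ≤ R := by simpa using haK.1
  have hva : ((M + h a : ℝ) : EReal) < v a := by
    have h1 : v x + ((-h x : ℝ) : EReal) ≤ v a + ((-h a : ℝ) : EReal) :=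
      hmax ⟨by simpa using hxR, hxρ⟩
    by_contra hle
    rw [not_lt] at hle
    have h2 : v a + ((-h a : ℝ) : EReal) ≤ M := by
      refine (add_le_add_left hle _).trans_eq ?_
      rw [← EReal.coe_add]; congr 1; ring
    have h3 := h1.trans h2
    rw [EReal.coe_neg] at h3
    have h4 := EReal.sub_le_iff_le_add (Or.inl (EReal.coe_ne_bot _))
        (Or.inl (EReal.coe_ne_top _)) |>.1 h3
    rw [← EReal.coe_add] at h4
    exact absurd h4 (not_le.2 hcon)
  have haρ : ρ < ‖a‖ := by
    by_contra hle
    exact absurd ((hin a (hρ.trans_le haK.2) (not_lt.1 hle)).trans (hMh a haR)) (not_le.2 hva)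
  have haR' : ‖a‖ < R := by
    refine lt_of_le_of_ne haR fun he => ?_
    exact absurd (hout a he) (not_le.2 hva)
  obtain ⟨l, hl, hexpa⟩ := hexp a haR'
  refine not_isMaxOn_sub_of_hasMeanExpansion_neg n hv hl hexpa hKU ?_ ?_ hmax
  · refine mem_of_superset ((Metric.isOpen_ball (x := (0 : Em (n + 1))) (ε := R)).inter
      (isOpen_lt continuous_const continuous_norm) |>.mem_nhds
        (⟨by simpa using haR', haρ⟩ : a ∈ _ ∩ {y | ρ < ‖y‖})) ?_
    exact inter_subset_inter Metric.ball_subset_closedBall fun y hy =>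
      show ρ ≤ ‖y‖ from le_of_lt hy
  · exact (bot_le.trans_lt hva).ne'

/-- A positive function, harmonic near the closed ball of radius `R`, which is at least `1` near
the boundary point `z` at scale `d` and of size `(d / R) ^ n` well inside. -/
def capBarrier (n : ℕ) (R : ℝ) (z : Em (n + 1)) (d : ℝ) (x : Em (n + 1)) : ℝ :=
  (2 * d) ^ n / R * poissonKernelAt n ((1 + d / R) • z) x

section capBarrier

variable {n : ℕ} {R d : ℝ} {z x : Em (n + 1)}

theorem norm_pole (hR : 0 < R) (hz : ‖z‖ = R) (hd : 0 < d) : ‖(1 + d / R) • z‖ = R + d := by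
  rw [norm_smul, hz, Real.norm_eq_abs, abs_of_pos (by positivity)]
  field_simp

theorem ne_pole (hR : 0 < R) (hz : ‖z‖ = R) (hd : 0 < d) (hx : ‖x‖ ≤ R) :
    x ≠ (1 + d / R) • z := by
  intro h
  have := norm_pole hR hz hd
  rw [← h] at this
  linarith

theorem rpow_norm_sq (x : Em (n + 1)) :
    (‖x‖ ^ 2) ^ (-((n + 1 : ℝ) / 2)) = (‖x‖ ^ (n + 1))⁻¹ := by
  rw [Real.rpow_neg (by positivity), ← Real.rpow_natCast ‖x‖ 2, ← Real.rpow_mul (norm_nonneg x),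
    ← Real.rpow_natCast ‖x‖ (n + 1)]
  congr 2
  push_cast
  ring

theorem capBarrier_eq (hR : 0 < R) (hz : ‖z‖ = R) (hd : 0 < d) :
    capBarrier n R z d x = (2 * d) ^ n / R *
      (((R + d) ^ 2 - ‖x‖ ^ 2) / ‖x - (1 + d / R) • z‖ ^ (n + 1)) := by
  rw [capBarrier, poissonKernelAt, rpow_norm_sq, norm_pole hR hz hd, ← div_eq_mul_inv]

theorem hasMeanExpansion_capBarrier (hR : 0 < R) (hz : ‖z‖ = R) (hd : 0 < d) (hx : ‖x‖ ≤ R) :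
    HasMeanExpansion n (capBarrier n R z d) x 0 := by
  simpa only [mul_zero] using! (hasMeanExpansion_poissonKernelAt n (ne_pole hR hz hd hx)).const_mul
    ((2 * d) ^ n / R)

theorem continuousOn_capBarrier (hR : 0 < R) (hz : ‖z‖ = R) (hd : 0 < d) :
    ContinuousOn (capBarrier n R z d) (Metric.closedBall 0 R) := by
  refine continuousOn_const.mul ((Continuous.continuousOn (by fun_prop)).mul ?_)
  refine ContinuousOn.rpow_const (Continuous.continuousOn (by fun_prop)) fun x hx => Or.inl ?_
  have := norm_pos_iff.2 (sub_ne_zero.2 (ne_pole hR hz hd (mem_closedBall_zero_iff.1 hx)))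
  positivity

theorem capBarrier_nonneg (hR : 0 < R) (hz : ‖z‖ = R) (hd : 0 < d) (hx : ‖x‖ ≤ R) :
    0 ≤ capBarrier n R z d x := by
  rw [capBarrier_eq hR hz hd]
  have : 0 ≤ (R + d) ^ 2 - ‖x‖ ^ 2 := by nlinarith [norm_nonneg x]
  positivity

theorem one_le_capBarrier (hR : 0 < R) (hz : ‖z‖ = R) (hd : 0 < d) (hx : ‖x‖ ≤ R)
    (hxz : dist x z ≤ d) : 1 ≤ capBarrier n R z d x := by
  rw [capBarrier_eq hR hz hd]
  have hpos := norm_pos_iff.2 (sub_ne_zero.2 (ne_pole hR hz hd hx))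
  have hle : ‖x - (1 + d / R) • z‖ ≤ 2 * d := by
    have h1 : x - (1 + d / R) • z = (x - z) - (d / R) • z := by rw [add_smul, one_smul]; abel
    have h2 : ‖(d / R) • z‖ = d := by
      rw [norm_smul, hz, Real.norm_eq_abs, abs_of_pos (by positivity)]; field_simp
    rw [h1]
    refine (norm_sub_le _ _).trans ?_
    rw [h2, ← dist_eq_norm]
    linarith
  calc (1 : ℝ) = (2 * d) ^ n / R * (2 * R * d / (2 * d) ^ (n + 1)) := by
        rw [pow_succ]; field_simp
    _ ≤ _ := by
        have hnum : 2 * R * d ≤ (R + d) ^ 2 - ‖x‖ ^ 2 := by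
          nlinarith [norm_nonneg x, sq_nonneg d]
        gcongr
        exact (by positivity : 0 ≤ 2 * R * d).trans hnum

theorem capBarrier_le (hR : 0 < R) (hz : ‖z‖ = R) (hd : 0 < d) (hdR : d ≤ 2 * R)
    (hx : ‖x‖ ≤ R / 2) : capBarrier n R z d x ≤ 18 * 4 ^ n * (d ^ n / R ^ n) := by
  rw [capBarrier_eq hR hz hd]
  have hge : R / 2 ≤ ‖x - (1 + d / R) • z‖ := by
    have := norm_sub_norm_le ((1 + d / R) • z) x
    rw [norm_pole hR hz hd, norm_sub_rev] at this
    linarith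
  calc _ ≤ (2 * d) ^ n / R * ((3 * R) ^ 2 / (R / 2) ^ (n + 1)) := by
        gcongr
        nlinarith [norm_nonneg x]
    _ = 18 * 4 ^ n * (d ^ n / R ^ n) := by
        rw [pow_succ (R / 2), div_pow, mul_pow, show (4 : ℝ) = 2 ^ 2 by norm_num, ← pow_mul]
        field_simp
        ring

end capBarrier

/-- A compact set of small Hausdorff measure is covered by finitely many small balls. -/
theorem IsCompact.exists_finset_cover_of_hausdorffMeasure_lt {X : Type*} [MetricSpace X] [Nonempty X]
    [MeasurableSpace X] [BorelSpace X] {n : ℕ} {K : Set X} (hK : IsCompact K) {c R : ℝ}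
    (hR : 0 < R) (hc : μH[(n : ℝ)] K < ENNReal.ofReal c) :
    ∃ (F : Finset ℕ) (z : ℕ → X) (d : ℕ → ℝ),
      (∀ i ∈ F, z i ∈ K ∧ 0 < d i ∧ d i ≤ 2 * R) ∧
      (∀ x ∈ K, ∃ i ∈ F, dist x (z i) ≤ d i) ∧ ∑ i ∈ F, d i ^ n ≤ c := by
  rw [Measure.hausdorffMeasure_apply] at hc
  have h1 := (le_iSup₂ (f := fun (r : ℝ≥0∞) (_ : 0 < r) =>
    ⨅ (t : ℕ → Set X) (_ : K ⊆ ⋃ n, t n) (_ : ∀ n, ediam (t n) ≤ r),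
      ∑' k, ⨆ _ : (t k).Nonempty, ediam (t k) ^ (n : ℝ))
      (ENNReal.ofReal R) (ENNReal.ofReal_pos.2 hR)).trans_lt hc
  simp only [iInf_lt_iff] at h1
  obtain ⟨t, htK, htd, hsum⟩ := h1
  have hcpos : 0 < c := ENNReal.ofReal_pos.1 (bot_le.trans_lt hsum)
  obtain ⟨ε, hε, hεsum⟩ := ENNReal.exists_pos_sum_of_countable (tsub_pos_of_lt hsum).ne' ℕ
  have hex : ∀ k, (t k ∩ K).Nonempty → ∃ (z : X) (d : ℝ), z ∈ K ∧ 0 < d ∧ d ≤ 2 * R ∧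
      (∀ x ∈ t k, dist x z < d) ∧ ENNReal.ofReal (d ^ n) ≤
        (⨆ _ : (t k).Nonempty, ediam (t k) ^ (n : ℝ)) + ε k := by
    rintro k ⟨z, hzt, hzK⟩
    have hne : (t k).Nonempty := ⟨z, hzt⟩
    have hfin : ediam (t k) ≠ ⊤ := ((htd k).trans_lt ENNReal.ofReal_lt_top).ne
    set D := (ediam (t k)).toReal with hD
    have hD0 : 0 ≤ D := ENNReal.toReal_nonneg
    have hDR : D ≤ R := ENNReal.toReal_le_of_le_ofReal hR.le (htd k)
    have hcont : ∀ᶠ d in 𝓝[>] D, d ^ n < D ^ n + ε k :=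
      ((continuous_pow n).tendsto D).eventually_lt_const
        (by have := hε k; simp only [lt_add_iff_pos_right, NNReal.coe_pos]; exact this)
        |>.filter_mono nhdsWithin_le_nhds
    have h2R : ∀ᶠ d in 𝓝[>] D, d < 2 * R :=
      (eventually_lt_nhds (by linarith)).filter_mono nhdsWithin_le_nhds
    obtain ⟨d, hd1, hd2, hd3⟩ := (hcont.and (h2R.and self_mem_nhdsWithin)).exists
    have hDd : D < d := hd3
    refine ⟨z, d, hzK, hD0.trans_lt hDd, hd2.le, fun x hx => ?_, ?_⟩
    · refine lt_of_le_of_lt ?_ hDd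
      rw [dist_edist]
      exact ENNReal.toReal_mono hfin (Metric.edist_le_ediam_of_mem hx hzt)
    · rw [iSup_pos hne, ENNReal.rpow_natCast, ← ENNReal.ofReal_toReal hfin, ← hD,
        ← ENNReal.ofReal_pow hD0, ← ENNReal.ofReal_coe_nnreal, ← ENNReal.ofReal_add
        (by positivity) (by positivity)]
      exact ENNReal.ofReal_le_ofReal hd1.le
  choose! z d hzK hd0 hdR hdist hdn using hex
  obtain ⟨b, hb, hbfin, hbK⟩ := hK.elim_finite_subcover_image
    (b := {k | (t k ∩ K).Nonempty}) (c := fun k => Metric.ball (z k) (d k))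
    (fun _ _ => Metric.isOpen_ball) (fun x hx => by
      obtain ⟨k, hk⟩ := mem_iUnion.1 (htK hx)
      exact mem_iUnion₂.2 ⟨k, ⟨x, hk, hx⟩, hdist k ⟨x, hk, hx⟩ x hk⟩)
  refine ⟨hbfin.toFinset, z, d, fun i hi => ?_, fun x hx => ?_, ?_⟩
  · have := hb (hbfin.mem_toFinset.1 hi)
    exact ⟨hzK i this, hd0 i this, hdR i this⟩
  · obtain ⟨i, hi, hxi⟩ := mem_iUnion₂.1 (hbK hx)
    exact ⟨i, hbfin.mem_toFinset.2 hi, (mem_ball.1 hxi).le⟩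
  · rw [← ENNReal.ofReal_le_ofReal_iff hcpos.le, ENNReal.ofReal_sum_of_nonneg
      (fun i hi => pow_nonneg (hd0 i (hb (hbfin.mem_toFinset.1 hi))).le n)]
    calc _ ≤ ∑ i ∈ hbfin.toFinset,
            ((⨆ _ : (t i).Nonempty, ediam (t i) ^ (n : ℝ)) + (ε i : ℝ≥0∞)) :=
          Finset.sum_le_sum fun i hi => hdn i (hb (hbfin.mem_toFinset.1 hi))
      _ ≤ ∑' i, ((⨆ _ : (t i).Nonempty, ediam (t i) ^ (n : ℝ)) + (ε i : ℝ≥0∞)) :=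
          ENNReal.sum_le_tsum _
      _ ≤ ENNReal.ofReal c := by
          rw [ENNReal.tsum_add]
          refine (add_le_add_right hεsum.le _).trans_eq ?_
          exact add_tsub_cancel_of_le hsum.le

/-- Two-constants type estimate: a bound `M + N` on a sphere which improves to `M` outside a set of
small surface measure yields a bound close to `M` in the ball of half the radius. -/
theorem le_add_of_small_exceptional_set (n : ℕ) {v : Em (n + 1) → EReal} {r₀ ρ R M N ε : ℝ}
    {E : Set (Em (n + 1))} (hv : SubharmonicOn (n + 1) v (Metric.closedBall 0 r₀)ᶜ)
    (hρ : r₀ < ρ) (hin : ∀ x, r₀ < ‖x‖ → ‖x‖ ≤ ρ → v x ≤ M) (hR : 0 < R) (hrR : r₀ < R)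
    (hN : 0 ≤ N) (hE : μH[(n : ℝ)] (E ∩ Metric.sphere 0 R) < ENNReal.ofReal (ε * R ^ n))
    (hout : ∀ x, ‖x‖ = R → x ∉ E → v x ≤ M)
    (hall : ∀ x, ‖x‖ = R → v x ≤ ((M + N : ℝ) : EReal))
    {x : Em (n + 1)} (hx0 : r₀ < ‖x‖) (hxR : ‖x‖ ≤ R / 2) :
    v x ≤ ((M + 18 * 4 ^ n * ε * N : ℝ) : EReal) := by
  by_contra hcon
  rw [not_le] at hcon
  obtain ⟨b, hb1, hb2⟩ := EReal.lt_iff_exists_real_btwn.1 hcon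
  rw [EReal.coe_lt_coe_iff] at hb1
  set δ := (b - (M + 18 * 4 ^ n * ε * N)) / 2 with hδ
  have hδ0 : 0 < δ := by rw [hδ]; linarith
  set K := Metric.sphere (0 : Em (n + 1)) R ∩ v ⁻¹' Ici ((M + δ : ℝ) : EReal) with hK
  have hKc : IsCompact K := by
    refine UpperSemicontinuousOn.isCompact_inter_preimage_Ici (hv.1.mono fun y hy => ?_)
      (isCompact_sphere _ _) _
    have : ‖y‖ = R := by simpa using hy
    simpa [this] using hrR
  have hKE : K ⊆ E ∩ Metric.sphere 0 R := by
    rintro y ⟨hyS, hyv⟩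
    refine ⟨by_contra fun hyE => ?_, hyS⟩
    have h1 := (show ((M + δ : ℝ) : EReal) ≤ v y from hyv).trans (hout y (by simpa using hyS) hyE)
    rw [EReal.coe_le_coe_iff] at h1
    linarith
  obtain ⟨F, z, d, hF, hcov, hsum⟩ := hKc.exists_finset_cover_of_hausdorffMeasure_lt hR
    ((measure_mono hKE).trans_lt hE)
  have hz : ∀ i ∈ F, ‖z i‖ = R := fun i hi => by simpa using (hF i hi).1.1
  set h : Em (n + 1) → ℝ := fun y => N * (∑ i ∈ F, capBarrier n R (z i) (d i) y) +
    δ / R ^ 2 * (R ^ 2 - ‖y‖ ^ 2) with hh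
  have hquad : ∀ y : Em (n + 1), ‖y‖ ≤ R → 0 ≤ δ / R ^ 2 * (R ^ 2 - ‖y‖ ^ 2) := fun y hy => by
    have : 0 ≤ R ^ 2 - ‖y‖ ^ 2 := by nlinarith [norm_nonneg y]
    positivity
  have hcap : ∀ y, ‖y‖ ≤ R → ∀ i ∈ F, 0 ≤ capBarrier n R (z i) (d i) y := fun y hy i hi =>
    capBarrier_nonneg hR (hz i hi) (hF i hi).2.1 hy
  have hcmp := le_add_of_hasMeanExpansion_neg n (M := M + δ) (R := R) (h := h) hv hρ ?_ ?_ ?_ ?_ ?_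
    hx0 (hxR.trans (by linarith))
  · refine absurd hcmp (not_le.2 (lt_of_le_of_lt ?_ hb2))
    rw [EReal.coe_le_coe_iff]
    have h1 : ∑ i ∈ F, capBarrier n R (z i) (d i) x ≤ 18 * 4 ^ n * ε := by
      calc _ ≤ ∑ i ∈ F, 18 * 4 ^ n * (d i ^ n / R ^ n) := Finset.sum_le_sum fun i hi =>
            capBarrier_le hR (hz i hi) (hF i hi).2.1 (hF i hi).2.2 hxR
        _ = 18 * 4 ^ n * ((∑ i ∈ F, d i ^ n) / R ^ n) := by
            rw [← Finset.mul_sum, Finset.sum_div]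
        _ ≤ 18 * 4 ^ n * ε := by
            gcongr
            rwa [div_le_iff₀ (by positivity)]
    have h2 : δ / R ^ 2 * (R ^ 2 - ‖x‖ ^ 2) ≤ δ := by
      rw [div_mul_eq_mul_div, div_le_iff₀ (by positivity)]
      nlinarith [mul_nonneg hδ0.le (sq_nonneg ‖x‖)]
    have h3 := mul_le_mul_of_nonneg_left h1 hN
    simp only [hh]
    linarith
  · refine (continuousOn_const.mul (continuousOn_finsetSum _ fun i hi =>
      continuousOn_capBarrier hR (hz i hi) (hF i hi).2.1)).add (Continuous.continuousOn ?_)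
    fun_prop
  · exact fun y hy => add_nonneg (mul_nonneg hN (Finset.sum_nonneg (hcap y hy))) (hquad y hy)
  · intro y hy
    have hneg : N * 0 + δ / R ^ 2 * (-1) < 0 := by
      rw [mul_zero, zero_add, mul_neg_one, neg_lt_zero]
      positivity
    refine ⟨_, hneg, ?_⟩
    exact ((HasMeanExpansion.sum F fun i hi => hasMeanExpansion_capBarrier hR (hz i hi)
      (hF i hi).2.1 hy.le).const_mul N).add
      ((HasMeanExpansion.const_sub_norm_sq (R ^ 2) y).const_mul (δ / R ^ 2))
  · exact fun y hy0 hyρ => (hin y hy0 hyρ).trans (EReal.coe_le_coe_iff.2 (by linarith))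
  · intro y hy
    by_cases hyK : y ∈ K
    · refine (hall y hy).trans (EReal.coe_le_coe_iff.2 ?_)
      obtain ⟨i, hi, hyi⟩ := hcov y hyK
      have h1 : 1 ≤ ∑ i ∈ F, capBarrier n R (z i) (d i) y :=
        (one_le_capBarrier hR (hz i hi) (hF i hi).2.1 hy.le hyi).trans
          (Finset.single_le_sum (hcap y hy.le) hi)
      have h2 := mul_le_mul_of_nonneg_left h1 hN
      have h3 := hquad y hy.le
      simp only [hh]
      linarith
    · have h1 : v y < ((M + δ : ℝ) : EReal) := by
        by_contra hle
        exact hyK ⟨by simpa using hy, not_lt.1 hle⟩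
      refine h1.le.trans (EReal.coe_le_coe_iff.2 ?_)
      have h2 := mul_nonneg hN (Finset.sum_nonneg (hcap y hy.le))
      have h3 := hquad y hy.le
      simp only [hh]
      linarith

theorem exists_pow_bound_of_ordE_lt_top {V : Type*} [NormedAddCommGroup V] {v : V → EReal}
    (h : ordE v < ⊤) : ∃ (p : ℕ) (s : ℝ), ∀ x, s < ‖x‖ → v x ≠ ⊤ → v x ≤ ((‖x‖ ^ p : ℝ) : EReal) := by
  obtain ⟨a, ha1, -⟩ := EReal.lt_iff_exists_real_btwn.1 h
  obtain ⟨p, hp⟩ := exists_nat_ge a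
  have hev := eventually_lt_of_limsup_lt (show ordE v < ((p : ℝ) : EReal) from
    ha1.trans_le (EReal.coe_le_coe_iff.2 hp))
  rw [← comap_norm_atTop, eventually_comap] at hev
  obtain ⟨s, hs⟩ := eventually_atTop.1 hev
  refine ⟨p, max s 1, fun x hx hv => ?_⟩
  have h1 := hs ‖x‖ ((le_max_left _ _).trans hx.le) x rfl
  have hx1 : 1 < ‖x‖ := (le_max_right _ _).trans_lt hx
  rw [EReal.coe_lt_coe_iff, div_lt_iff₀ (Real.log_pos hx1), ← Real.log_pow,
    Real.log_lt_log_iff (by positivity) (by positivity)] at h1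
  refine (EReal.le_coe_toReal hv).trans (EReal.coe_le_coe_iff.2 ?_)
  linarith [le_max_left (v x).toReal 0]

theorem exists_global_pow_bound {m : ℕ} {v : Em m → EReal} {r₀ ρ M : ℝ}
    (hv : SubharmonicOn m v (Metric.closedBall 0 r₀)ᶜ) (hρ : r₀ < ρ)
    (hin : ∀ x, r₀ < ‖x‖ → ‖x‖ ≤ ρ → v x ≤ M) (hord : ordE v < ⊤) :
    ∃ (p : ℕ) (A : ℝ), 0 ≤ A ∧ ∀ s : ℝ, 1 ≤ s → ∀ x, r₀ < ‖x‖ → ‖x‖ ≤ s →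
      v x ≤ ((M + A * s ^ p : ℝ) : EReal) := by
  obtain ⟨p, s₁, hp⟩ := exists_pow_bound_of_ordE_lt_top hord
  have hU : ∀ x, r₀ < ‖x‖ → x ∈ (Metric.closedBall (0 : Em m) r₀)ᶜ := fun x hx => by simpa using hx
  set K : Set (Em m) := Metric.closedBall 0 s₁ ∩ {y | ρ ≤ ‖y‖} with hK
  have hKc : IsCompact K :=
    (isCompact_closedBall _ _).inter_right (isClosed_le continuous_const continuous_norm)
  have hKU : K ⊆ (Metric.closedBall 0 r₀)ᶜ := fun y hy => hU y (hρ.trans_le hy.2)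
  obtain ⟨N, hN⟩ : ∃ N : ℝ, ∀ y ∈ K, v y ≤ N := by
    rcases K.eq_empty_or_nonempty with he | hne
    · exact ⟨0, fun y hy => by simp [he] at hy⟩
    · obtain ⟨a, haK, hmax⟩ := UpperSemicontinuousOn.exists_isMaxOn hne hKc (hv.1.mono hKU)
      exact ⟨(v a).toReal, fun y hy => (hmax hy).trans (EReal.le_coe_toReal (hv.2.1 a (hKU haK)))⟩
  refine ⟨p, |M| + |N| + 1, by positivity, fun s hs x hx0 hxs => ?_⟩
  have hsp : 1 ≤ s ^ p := one_le_pow₀ hs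
  have hA : |M| + |N| + 1 ≤ (|M| + |N| + 1) * s ^ p := le_mul_of_one_le_right (by positivity) hsp
  rcases le_or_gt ‖x‖ ρ with h1 | h1
  · refine (hin x hx0 h1).trans (EReal.coe_le_coe_iff.2 ?_)
    linarith [abs_nonneg M, abs_nonneg N]
  rcases le_or_gt ‖x‖ s₁ with h2 | h2
  · refine (hN x ⟨by simpa using h2, h1.le⟩).trans (EReal.coe_le_coe_iff.2 ?_)
    linarith [neg_abs_le M, le_abs_self N]
  · refine (hp x h2 (hv.2.1 x (hU x hx0))).trans (EReal.coe_le_coe_iff.2 ?_)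
    have h3 : ‖x‖ ^ p ≤ s ^ p := pow_le_pow_left₀ (norm_nonneg x) hxs p
    nlinarith [neg_abs_le M, abs_nonneg M, abs_nonneg N]

/-- If the ratios of consecutive terms are eventually at most `C`, then every large `s` is followed
by a term of comparable size. -/
theorem exists_term_comparable {r : ℕ → ℝ} (hmono : Monotone r) (hunb : Tendsto r atTop atTop)
    {C : ℝ} (hC : 0 ≤ C) {k₁ : ℕ} (hratio : ∀ k ≥ k₁, r (k + 1) ≤ C * r k) {s : ℝ}
    (hs : r k₁ < s) : ∃ k ≥ k₁, s ≤ r k ∧ r k ≤ C * s := by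
  have hex : ∃ k, s ≤ r k := (hunb.eventually_ge_atTop s).exists
  set k := Nat.find hex with hk
  have hsk : s ≤ r k := Nat.find_spec hex
  have hlt : k₁ < k := by
    by_contra hle
    linarith [hmono (not_lt.1 hle)]
  obtain ⟨j, hj⟩ := Nat.exists_eq_add_of_lt hlt
  have hjs : r (k₁ + j) < s := not_le.1 (Nat.find_min hex (by omega))
  refine ⟨k, hlt.le, hsk, ?_⟩
  rw [hj]
  exact (hratio (k₁ + j) (by omega)).trans (mul_le_mul_of_nonneg_left hjs.le hC)

theorem le_of_sparse_exceptional_set (n : ℕ) {v : Em (n + 1) → EReal} {r₀ M : ℝ}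
    {E : Set (Em (n + 1))} {r : ℕ → ℝ} (hrpos : ∀ k, 0 < r k) (hrmono : Monotone r)
    (hrunb : Tendsto r atTop atTop) (hr1 : r₀ < r 0)
    (hratio : Filter.limsup (fun k => ((r (k + 1) / r k : ℝ) : EReal)) atTop < ⊤)
    (hsmall : Tendsto (fun k => μH[(n : ℝ)] (E ∩ Metric.sphere (0 : Em (n + 1)) (r k)) /
      ENNReal.ofReal ((r k) ^ n)) atTop (𝓝 0))
    (hv : SubharmonicOn (n + 1) v (Metric.closedBall 0 r₀)ᶜ) (hord : ordE v < ⊤)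
    (hin : ∀ x, r₀ < ‖x‖ → ‖x‖ ≤ r 0 → v x ≤ M) (hout : ∀ x, r₀ < ‖x‖ → x ∉ E → v x ≤ M)
    {x : Em (n + 1)} (hx : r₀ < ‖x‖) : v x ≤ M := by
  obtain ⟨p, A, hA, hgrowth⟩ := exists_global_pow_bound hv hr1 hin hord
  obtain ⟨C, hC0, hC⟩ : ∃ C : ℝ, 0 < C ∧ ∀ᶠ k in atTop, r (k + 1) ≤ C * r k := by
    obtain ⟨a, ha, -⟩ := EReal.lt_iff_exists_real_btwn.1 hratio
    refine ⟨max a 1, by positivity, ?_⟩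
    filter_upwards [eventually_lt_of_limsup_lt ha] with k hk
    rw [EReal.coe_lt_coe_iff, div_lt_iff₀ (hrpos k)] at hk
    exact hk.le.trans (mul_le_mul_of_nonneg_right (le_max_left _ _) (hrpos k).le)
  set ε : ℝ := 1 / (18 * 4 ^ n * (2 * (C * 2) ^ p)) with hε
  have hε0 : 0 < ε := by positivity
  have hEk : ∀ᶠ k in atTop, μH[(n : ℝ)] (E ∩ Metric.sphere (0 : Em (n + 1)) (r k)) <
      ENNReal.ofReal (ε * r k ^ n) := by
    filter_upwards [hsmall.eventually_lt_const (ENNReal.ofReal_pos.2 hε0)] with k hk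
    have hpos : 0 < r k ^ n := pow_pos (hrpos k) n
    rwa [ENNReal.div_lt_iff (Or.inl (ENNReal.ofReal_pos.2 hpos).ne') (Or.inl ENNReal.ofReal_ne_top),
      ← ENNReal.ofReal_mul hε0.le] at hk
  obtain ⟨k₁, hk₁⟩ := eventually_atTop.1 (hC.and hEk)
  have hiter : ∀ j : ℕ, ∀ s : ℝ, 1 ≤ s → r k₁ ≤ s → ∀ x, r₀ < ‖x‖ → ‖x‖ ≤ s →
      v x ≤ ((M + A * s ^ p * (1 / 2) ^ j : ℝ) : EReal) := by
    intro j
    induction j with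
    | zero =>
      intro s hs _ x hx0 hxs
      simpa using hgrowth s hs x hx0 hxs
    | succ j ih =>
      intro s hs hsk x hx0 hxs
      obtain ⟨k, hkk₁, hsrk, hrks⟩ := exists_term_comparable hrmono hrunb hC0.le
        (fun k hk => (hk₁ k hk).1) (show r k₁ < 2 * s by linarith)
      have hrk : r₀ < r k := hr1.trans_le (hrmono (Nat.zero_le k))
      have hstep := le_add_of_small_exceptional_set n (E := E) (R := r k) (M := M) (ε := ε)
        (N := A * (C * (2 * s)) ^ p * (1 / 2) ^ j) hv hr1 hin (hrpos k) hrk (by positivity)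
        (hk₁ k hkk₁).2 (fun y hy => hout y (hy ▸ hrk))
        (fun y hy => ih (C * (2 * s)) (by linarith) (by linarith) y (hy ▸ hrk) (hy ▸ hrks))
        hx0 (by linarith)
      refine hstep.trans_eq ?_
      congr 2
      rw [hε, show C * (2 * s) = C * 2 * s by ring, mul_pow (C * 2) s, pow_succ]
      field_simp
  set s := max (max 1 (r k₁)) ‖x‖ with hs
  have hlim : Tendsto (fun j : ℕ => ((M + A * s ^ p * (1 / 2) ^ j : ℝ) : EReal)) atTop
      (𝓝 (M : EReal)) := by
    refine (continuous_coe_real_ereal.tendsto M).comp ?_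
    have := (tendsto_pow_atTop_nhds_zero_of_lt_one (r := (1 / 2 : ℝ)) (by norm_num)
      (by norm_num)).const_mul (A * s ^ p) |>.const_add M
    simpa using this
  exact ge_of_tendsto' hlim fun j => hiter j s ((le_max_left _ _).trans (le_max_left _ _))
    ((le_max_right _ _).trans (le_max_left _ _)) x hx (le_max_right _ _)

/-- Main theorem: a subharmonic function of finite order on `ℝᵐ \ B̄(0,r₀)` which is
bounded via the sup over the complement of a set `E` that is asymptotically small on a
commensurable sequence of spheres satisfies
`sup_{ℝᵐ \ B̄(0,r₀)} v = max{M_E, M₀}`.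
Here the sequence `(r k)_{k ∈ ℕ}` is indexed from `0`, so `r 0` plays the role of `r₁`. -/
theorem liouville_main_theorem (m : ℕ) (hm : 1 ≤ m) (r₀ : ℝ) (hr₀ : 0 ≤ r₀)
    (E : Set (Em m)) (r : ℕ → ℝ)
    (hrpos : ∀ k, 0 < r k) (hrmono : Monotone r)
    (hrunb : Tendsto r atTop atTop)
    (hr1 : r₀ < r 0)
    (hratio : Filter.limsup (fun k => ((r (k + 1) / r k : ℝ) : EReal)) atTop < ⊤)
    (hmeas : ∀ k, MeasurableSet (E ∩ Metric.sphere (0 : Em m) (r k)))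
    (hsmall : Tendsto
      (fun k => μH[(m : ℝ) - 1] (E ∩ Metric.sphere (0 : Em m) (r k)) /
        ENNReal.ofReal ((r k) ^ (m - 1))) atTop (𝓝 0))
    (v : Em m → EReal)
    (hsub : SubharmonicOn m v (Metric.closedBall (0 : Em m) r₀)ᶜ)
    (hord : ordE v < ⊤) :
    sSup (v '' (Metric.closedBall (0 : Em m) r₀)ᶜ) =
      max (sSup (v '' ((Metric.closedBall (0 : Em m) r₀)ᶜ \ E)))
        (sSup (v '' (Metric.closedBall (0 : Em m) (r 0) \ Metric.closedBall (0 : Em m) r₀))) := by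
  obtain ⟨n, rfl⟩ : ∃ n, m = n + 1 := ⟨m - 1, by omega⟩
  have hU : ∀ x : Em (n + 1), x ∈ (Metric.closedBall (0 : Em (n + 1)) r₀)ᶜ ↔ r₀ < ‖x‖ := by simp
  refine le_antisymm (sSup_le ?_) (max_le (sSup_le_sSup (image_mono sdiff_subset))
    (sSup_le_sSup (image_mono fun x hx => hx.2)))
  rintro _ ⟨x, hx, rfl⟩
  by_contra hcon
  obtain ⟨M, hM1, hM2⟩ := EReal.lt_iff_exists_real_btwn.1 (not_le.1 hcon)
  rw [max_lt_iff] at hM1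
  simp only [cast_succ_sub_one, Nat.add_sub_cancel] at hsmall
  refine absurd (le_of_sparse_exceptional_set n hrpos hrmono hrunb hr1 hratio hsmall hsub hord
    (fun y hy0 hy1 => ?_) (fun y hy0 hyE => ?_) ((hU x).1 hx)) (not_le.2 hM2)
  · have hy : y ∈ Metric.closedBall (0 : Em (n + 1)) (r 0) \ Metric.closedBall 0 r₀ :=
      ⟨by simpa using hy1, (hU y).2 hy0⟩
    exact (le_sSup (mem_image_of_mem v hy)).trans hM1.2.le
  · have hy : y ∈ (Metric.closedBall (0 : Em (n + 1)) r₀)ᶜ \ E := ⟨(hU y).2 hy0, hyE⟩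
    exact (le_sSup (mem_image_of_mem v hy)).trans hM1.1.le
end
end

section
/- Let m ∈ ℕ, E ⊂ ℝᵐ, and let (r_k)_{k∈ℕ} be an unbounded increasing sequence of positive real numbers with limsup_{k→∞} r_{k+1}/r_k < +∞, such that each set E_k := E ∩ S(0, r_k) is σ_{r_k}-measurable and lim_{k→∞} σ_{r_k}(E_k)/r_k^{m-1} = 0. If a convex function v : ℝᵐ → ℝ has finite order and is bounded above on ℝᵐ \ E, then v is constant on ℝᵐ. -/
open MeasureTheory Metric Filter Set
open scoped ENNReal NNReal Topology

noncomputable section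

open Module in
/-- The Hausdorff measure of a spherical cap of angular radius `π / 3` dominates that of the ball
of half the radius in the hyperplane orthogonal to its axis. -/
theorem hausdorffMeasure_cap_ge {V : Type*} [NormedAddCommGroup V] [InnerProductSpace ℝ V]
    [FiniteDimensional ℝ V] [MeasurableSpace V] [BorelSpace V] {e : V} (he : ‖e‖ = 1)
    {r : ℝ} (hr : 0 < r) :
    ENNReal.ofReal (r ^ finrank ℝ (ℝ ∙ e)ᗮ) *
        μH[finrank ℝ (ℝ ∙ e)ᗮ] (ball (0 : (ℝ ∙ e)ᗮ) (1 / 2)) ≤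
      μH[finrank ℝ (ℝ ∙ e)ᗮ] {y ∈ sphere (0 : V) r | r / 2 < inner ℝ e y} := by
  rw [← Measure.addHaar_ball_mul_of_pos _ 0 hr]
  refine le_trans (measure_mono ?_)
    (hausdorffMeasure_orthogonalProjectionOnto_le (ℝ ∙ e)ᗮ _ _ (Nat.cast_nonneg _))
  intro w hw
  have hw' : ‖w‖ < r * (1 / 2) := by simpa using hw
  have hew : inner ℝ e (w : V) = 0 := Submodule.mem_orthogonal_singleton_iff_inner_right.1 w.2
  have hsq : r ^ 2 / 4 < r ^ 2 - ‖w‖ ^ 2 := by nlinarith [norm_nonneg w]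
  have hpos : 0 ≤ r ^ 2 - ‖w‖ ^ 2 := by nlinarith
  have hlt : r / 2 < √(r ^ 2 - ‖w‖ ^ 2) := Real.lt_sqrt_of_sq_lt (by linarith [hsq, div_pow r 2 2])
  refine ⟨w + √(r ^ 2 - ‖w‖ ^ 2) • e, ⟨?_, ?_⟩, ?_⟩
  · have h : ‖(w : V) + √(r ^ 2 - ‖w‖ ^ 2) • e‖ ^ 2 = r ^ 2 := by
      rw [norm_add_sq_real, inner_smul_right, real_inner_comm, hew, norm_smul, he, mul_one,
        Real.norm_eq_abs, sq_abs, Real.sq_sqrt hpos, Submodule.coe_norm]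
      ring
    rw [mem_sphere_zero_iff_norm]
    exact (sq_eq_sq₀ (norm_nonneg _) hr.le).1 h
  · simpa [inner_add_right, inner_smul_right, hew, he] using hlt
  · rw [map_add, map_smul, Submodule.orthogonalProjectionOnto_orthogonalComplement_singleton_eq_zero,
      smul_zero, add_zero, Submodule.orthogonalProjectionOnto_mem_subspace_eq_self]

/-- A convex function on a vector space that is bounded above is constant. -/
theorem ConvexOn.eq_of_forall_le {V : Type*} [AddCommGroup V] [Module ℝ V] {v : V → ℝ}
    (hv : ConvexOn ℝ univ v) {M : ℝ} (hM : ∀ x, v x ≤ M) (x y : V) : v x = v y := by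
  suffices h : ∀ x y, v y ≤ v x from le_antisymm (h y x) (h x y)
  intro x y
  by_contra! hxy
  have hd : 0 < M - v x := by linarith [hM y]
  set s : ℝ := (v y - v x) / (2 * (M - v x)) with hs
  have hs0 : 0 < s := div_pos (by linarith) (by linarith)
  have hs1 : s ≤ 1 := (div_le_one (by linarith)).2 (by linarith [hM y])
  have hsM : s * (M - v x) = (v y - v x) / 2 := by rw [hs]; field_simp
  have hc := hv.2 (mem_univ x) (mem_univ (x + s⁻¹ • (y - x))) (sub_nonneg.2 hs1) hs0.le (by ring)
  have hy : (1 - s) • x + s • (x + s⁻¹ • (y - x)) = y := by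
    rw [smul_add, smul_inv_smul₀ hs0.ne']
    module
  rw [hy, smul_eq_mul, smul_eq_mul] at hc
  nlinarith [mul_le_mul_of_nonneg_left (hM (x + s⁻¹ • (y - x))) hs0.le]

/-- A convex function on a finite-dimensional inner product space that takes a value at most `M` and
a value greater than `M` is greater than `M` on a whole open half-space. -/
theorem ConvexOn.exists_halfSpace_lt {V : Type*} [NormedAddCommGroup V] [InnerProductSpace ℝ V]
    [FiniteDimensional ℝ V] {v : V → ℝ} (hv : ConvexOn ℝ univ v) {M : ℝ} {a x : V}
    (ha : v a ≤ M) (hx : M < v x) :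
    ∃ (e : V) (c : ℝ), ‖e‖ = 1 ∧ ∀ y, c < inner ℝ e y → M < v y := by
  have hcont : Continuous v := continuousOn_univ.1 (hv.continuousOn isOpen_univ)
  have hconvex : Convex ℝ {y | v y ≤ M} := by simpa using hv.convex_le M
  obtain ⟨f, u, hf, hu⟩ := geometric_hahn_banach_closed_point hconvex
    (isClosed_le hcont continuous_const) (not_le.2 hx)
  set g := (InnerProductSpace.toDual ℝ V).symm f with hg
  have hfg : ∀ y, f y = inner ℝ g y := fun y => (InnerProductSpace.toDual_symm_apply).symm
  have hg0 : g ≠ 0 := by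
    intro h
    have h1 := hf a ha
    rw [hfg, h, inner_zero_left] at h1 hu
    linarith
  have hgn : 0 < ‖g‖ := norm_pos_iff.2 hg0
  refine ⟨‖g‖⁻¹ • g, ‖g‖⁻¹ * u, by simp [norm_smul, hgn.ne'], fun y hy => ?_⟩
  rw [real_inner_smul_left, ← hfg] at hy
  by_contra! h
  exact (hf y h).not_gt (lt_of_mul_lt_mul_left hy (inv_nonneg.2 hgn.le))

/-- A convex function of finite order on `ℝᵐ`, bounded above outside a set `E` that is
asymptotically small on a commensurable sequence of spheres, is constant. -/
theorem convex_finite_order_constant (m : ℕ) (hm : 1 ≤ m)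
    (E : Set (Em m)) (r : ℕ → ℝ)
    (hrpos : ∀ k, 0 < r k) (hrmono : Monotone r)
    (hrunb : Tendsto r atTop atTop)
    (hratio : Filter.limsup (fun k => ((r (k + 1) / r k : ℝ) : EReal)) atTop < ⊤)
    (hmeas : ∀ k, MeasurableSet (E ∩ Metric.sphere (0 : Em m) (r k)))
    (hsmall : Tendsto
      (fun k => μH[(m : ℝ) - 1] (E ∩ Metric.sphere (0 : Em m) (r k)) /
        ENNReal.ofReal ((r k) ^ (m - 1))) atTop (𝓝 0))
    (v : Em m → ℝ)
    (hconv : ConvexOn ℝ Set.univ v)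
    (hord : ordR v < ⊤)
    (hbd : ∃ M : ℝ, ∀ x ∉ E, v x ≤ M) :
    ∀ x y : Em m, v x = v y := by
  obtain ⟨M, hM⟩ := hbd
  refine hconv.eq_of_forall_le (M := max M (v 0)) fun x => ?_
  by_contra! hx
  obtain ⟨e, c, he, hec⟩ := hconv.exists_halfSpace_lt (le_max_right M (v 0)) hx
  have hE : ∀ y, c < inner ℝ e y → y ∈ E := fun y hy => by
    by_contra hyE
    exact ((le_max_left M (v 0)).trans_lt (hec y hy)).not_ge (hM y hyE)
  have he0 : e ≠ 0 := norm_ne_zero_iff.1 (by rw [he]; exact one_ne_zero)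
  have hfin : Module.finrank ℝ (ℝ ∙ e)ᗮ = m - 1 := by
    have : Fact (Module.finrank ℝ (Em m) = (m - 1) + 1) :=
      ⟨by rw [finrank_euclideanSpace_fin, Nat.sub_add_cancel hm]⟩
    exact Submodule.finrank_orthogonal_span_singleton he0
  have hcast : (m : ℝ) - 1 = (Module.finrank ℝ (ℝ ∙ e)ᗮ : ℝ) := by
    rw [hfin, Nat.cast_sub hm, Nat.cast_one]
  have hball : 0 < μH[(Module.finrank ℝ (ℝ ∙ e)ᗮ : ℝ)] (ball (0 : (ℝ ∙ e)ᗮ) (1 / 2)) :=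
    measure_ball_pos _ _ one_half_pos
  obtain ⟨k, hk, hck⟩ := ((hsmall.eventually_lt_const hball).and
    (hrunb.eventually_ge_atTop (2 * c))).exists
  have hrk := pow_pos (hrpos k) (m - 1)
  rw [hcast, ENNReal.div_lt_iff (.inl (ENNReal.ofReal_pos.2 hrk).ne') (.inl ENNReal.ofReal_ne_top),
    mul_comm] at hk
  refine hk.not_ge ?_
  rw [← hfin]
  refine (hausdorffMeasure_cap_ge he (hrpos k)).trans (measure_mono ?_)
  rintro y ⟨hy, hey⟩
  exact ⟨hE y (by linarith), hy⟩
end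
end

section
/- Let m ∈ ℕ, E ⊂ ℝᵐ, and let (r_k)_{k∈ℕ} be an unbounded increasing sequence of positive real numbers with limsup_{k→∞} r_{k+1}/r_k < +∞, such that each set E_k := E ∩ S(0, r_k) is σ_{r_k}-measurable and lim_{k→∞} σ_{r_k}(E_k)/r_k^{m-1} = 0. If a harmonic function v on ℝᵐ has finite order and is bounded above on ℝᵐ \ E, then v is constant on ℝᵐ. -/
open MeasureTheory Metric Filter Set
open scoped ENNReal NNReal Topology

noncomputable section

/-- Mean of a real-valued function over the sphere `S(x,t) ⊂ ℝᵐ`, with respect to the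
surface measure (the `(m-1)`-dimensional Hausdorff measure). -/
def rSMean (m : ℕ) (v : Em m → ℝ) (x : Em m) (t : ℝ) : ℝ :=
  (1 / (sphereArea m * t ^ (m - 1))) *
    ∫ y, v y ∂((μH[(m : ℝ) - 1]).restrict (Metric.sphere x t))

/-- Harmonicity on a set `U ⊆ ℝᵐ`, characterized by continuity together with the mean
value property over every sphere whose closed ball lies in `U`. -/
def HarmonicOn (m : ℕ) (v : Em m → ℝ) (U : Set (Em m)) : Prop :=
  ContinuousOn v U ∧
    ∀ x ∈ U, ∀ t : ℝ, 0 < t → Metric.closedBall x t ⊆ U → v x = rSMean m v x t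

/-! ### Averages over the orthogonal group -/

section Rotations

variable {E : Type*} [NormedAddCommGroup E] [InnerProductSpace ℝ E] [FiniteDimensional ℝ E]

instance continuousStar_endomorphism : ContinuousStar (E →L[ℝ] E) :=
  ⟨(ContinuousLinearMap.adjoint (𝕜 := ℝ) (E := E) (F := E)).continuous⟩

instance compactSpace_unitary : CompactSpace (unitary (E →L[ℝ] E)) := by
  refine (isCompact_iff_compactSpace (X := E →L[ℝ] E)).mp ?_
  refine Metric.isCompact_of_isClosed_isBounded isClosed_unitary ?_
  refine (Metric.isBounded_closedBall (x := (0 : E →L[ℝ] E)) (r := 1)).subset fun T hT => ?_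
  rw [mem_closedBall_zero_iff]
  exact T.opNorm_le_bound zero_le_one fun x => by simp [T.norm_map_of_mem_unitary hT]

variable (E) in
/-- The Haar probability measure on the orthogonal group of `E`. -/
def rotHaar : Measure (unitary (E →L[ℝ] E)) := Measure.haarMeasure ⊤

instance isHaarMeasure_rotHaar : (rotHaar E).IsHaarMeasure := by unfold rotHaar; infer_instance

instance isProbabilityMeasure_rotHaar : IsProbabilityMeasure (rotHaar E) :=
  ⟨by simpa using! Measure.haarMeasure_self (G := unitary (E →L[ℝ] E)) (K₀ := ⊤)⟩

instance isMulRightInvariant_rotHaar : (rotHaar E).IsMulRightInvariant := ⟨fun g => by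
  have : IsProbabilityMeasure ((rotHaar E).map (· * g)) :=
    Measure.isProbabilityMeasure_map (by fun_prop)
  exact Measure.isHaarMeasure_eq_of_isProbabilityMeasure _ _⟩

/-- The mean of `f` over the sphere centered at `x` through `x + y`, computed by averaging over
rotations around `x`. -/
def rotMean (f : E → ℝ) (x y : E) : ℝ :=
  ∫ T : unitary (E →L[ℝ] E), f (x + (T : E →L[ℝ] E) y) ∂rotHaar E

lemma exists_rotation_apply_eq {x y : E} (h : ‖x‖ = ‖y‖) :
    ∃ S : unitary (E →L[ℝ] E), (S : E →L[ℝ] E) x = y :=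
  ⟨Unitary.linearIsometryEquiv.symm ((Submodule.span ℝ {x - y})ᗮ.reflection), by
    simpa using Submodule.reflection_sub h⟩

@[fun_prop]
lemma Continuous.rotation_apply {X : Type*} [TopologicalSpace X]
    {T : X → unitary (E →L[ℝ] E)} {g : X → E} (hT : Continuous T) (hg : Continuous g) :
    Continuous fun p => (T p : E →L[ℝ] E) (g p) :=
  (continuous_subtype_val.comp hT).clm_apply hg

lemma integrable_rotHaar {g : unitary (E →L[ℝ] E) → ℝ} (hg : Continuous g) :
    Integrable g (rotHaar E) :=
  hg.integrable_of_hasCompactSupport (HasCompactSupport.of_compactSpace g)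

lemma rotMean_eq_of_norm_eq (f : E → ℝ) (x : E) {y z : E} (h : ‖y‖ = ‖z‖) :
    rotMean f x y = rotMean f x z := by
  obtain ⟨S, rfl⟩ := exists_rotation_apply_eq h
  exact (integral_mul_right_eq_self
    (fun T : unitary (E →L[ℝ] E) => f (x + (T : E →L[ℝ] E) y)) S).symm

lemma continuous_integral_rotHaar {X : Type*} [TopologicalSpace X] [FirstCountableTopology X]
    [LocallyCompactSpace X] {F : X → unitary (E →L[ℝ] E) → ℝ}
    (hF : Continuous (Function.uncurry F)) : Continuous fun x => ∫ T, F x T ∂rotHaar E := by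
  simpa using! continuous_parametric_integral_of_continuous (μ := rotHaar E) hF isCompact_univ

lemma continuous_rotMean {f : E → ℝ} (hf : Continuous f) (x : E) : Continuous (rotMean f x) :=
  continuous_integral_rotHaar
    (F := fun (y : E) (T : unitary (E →L[ℝ] E)) => f (x + (T : E →L[ℝ] E) y))
    (by unfold Function.uncurry; fun_prop)

/-- Continuous functions bounded by their means over all spheres. -/
structure IsSubMean (u : E → ℝ) : Prop where
  continuous : Continuous u
  le_rotMean : ∀ x y, u x ≤ rotMean u x y

lemma isSubMean_rotMean {u : E → ℝ} (hu : IsSubMean u) : IsSubMean (rotMean u 0) := by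
  have hc := hu.continuous
  refine ⟨continuous_rotMean hc 0, fun x y => ?_⟩
  have hswap : rotMean (rotMean u 0) x y =
      ∫ T : unitary (E →L[ℝ] E), rotMean u ((T : E →L[ℝ] E) x) y ∂rotHaar E := by
    unfold rotMean
    rw [integral_integral_swap]
    · refine integral_congr_ae (.of_forall fun T => ?_)
      refine Eq.trans ?_ (integral_mul_left_eq_self
        (fun S : unitary (E →L[ℝ] E) => u ((T : E →L[ℝ] E) x + (S : E →L[ℝ] E) y)) T)
      simp
    · refine Continuous.integrable_of_hasCompactSupport ?_ (HasCompactSupport.of_compactSpace _)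
      unfold Function.uncurry
      fun_prop
  rw [hswap]
  unfold rotMean
  refine integral_mono (integrable_rotHaar (by fun_prop)) (integrable_rotHaar ?_) fun T => ?_
  · refine continuous_integral_rotHaar (F := fun (T S : unitary (E →L[ℝ] E)) =>
      u ((T : E →L[ℝ] E) x + (S : E →L[ℝ] E) y)) ?_
    unfold Function.uncurry
    fun_prop
  · simpa only [zero_add] using! hu.le_rotMean ((T : E →L[ℝ] E) x) y

lemma IsSubMean.rotMean_mono {u : E → ℝ} (hu : IsSubMean u) {y z : E} (h : ‖y‖ ≤ ‖z‖) :
    rotMean u 0 y ≤ rotMean u 0 z := by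
  set L := rotMean u 0 with hL
  have hLc : Continuous L := (isSubMean_rotMean hu).continuous
  obtain ⟨p, hp, hmax⟩ := (isCompact_closedBall (0 : E) ‖z‖).exists_isMaxOn
    ⟨y, by simpa using h⟩ hLc.continuousOn
  rw [mem_closedBall_zero_iff] at hp
  obtain ⟨w, hw, hpw⟩ : ∃ w : E, ‖w‖ = ‖z‖ - ‖p‖ ∧ ‖p + w‖ = ‖z‖ := by
    rcases eq_or_ne p 0 with rfl | hp0
    · exact ⟨z, by simp⟩
    · have hp' : ‖p‖ ≠ 0 := norm_ne_zero_iff.mpr hp0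
      refine ⟨((‖z‖ - ‖p‖) / ‖p‖) • p, ?_, ?_⟩
      · rw [norm_smul, Real.norm_of_nonneg (div_nonneg (by linarith) (norm_nonneg _))]
        field_simp
      · have : p + ((‖z‖ - ‖p‖) / ‖p‖) • p = (‖z‖ / ‖p‖) • p := by
          rw [sub_div, div_self hp', sub_smul, one_smul]; abel
        rw [this, norm_smul, norm_div, norm_norm, norm_norm]
        field_simp
  have hle : ∀ T : unitary (E →L[ℝ] E), L (p + (T : E →L[ℝ] E) w) ≤ L p := fun T => by
    refine hmax ?_
    rw [mem_closedBall_zero_iff]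
    refine (norm_add_le _ _).trans ?_
    rw [Unitary.norm_map, hw]
    linarith
  have hcont : Continuous fun T : unitary (E →L[ℝ] E) => L p - L (p + (T : E →L[ℝ] E) w) := by
    fun_prop
  have hzero : L p - L (p + w) = 0 := by
    by_contra hne
    have hpos := hcont.integral_pos_of_hasCompactSupport_nonneg_nonzero (μ := rotHaar E) (x := 1)
      (HasCompactSupport.of_compactSpace _) (fun T => sub_nonneg.mpr (hle T)) (by simpa using hne)
    rw [integral_sub (integrable_const _) (integrable_rotHaar (by fun_prop))] at hpos
    have := (isSubMean_rotMean hu).le_rotMean p w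
    simp only [integral_const, probReal_univ, one_smul] at hpos
    have h2 : rotMean L p w =
      ∫ T : unitary (E →L[ℝ] E), L (p + (T : E →L[ℝ] E) w) ∂rotHaar E := rfl
    rw [← h2] at hpos
    linarith
  calc L y ≤ L p := hmax (by simpa using h)
    _ = L (p + w) := by linarith
    _ = L z := rotMean_eq_of_norm_eq u 0 hpw

lemma IsSubMean.max_zero {v : E → ℝ} (hv : IsSubMean v) : IsSubMean fun x => max (v x) 0 := by
  have hc := hv.continuous
  refine ⟨hc.max continuous_const, fun x y => max_le ((hv.le_rotMean x y).trans ?_) ?_⟩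
  · exact integral_mono (integrable_rotHaar (by fun_prop)) (integrable_rotHaar (by fun_prop))
      fun T => le_max_left _ _
  · exact integral_nonneg fun T => le_max_right _ _

/-! ### Volume means -/

variable [MeasurableSpace E] [BorelSpace E]

lemma setIntegral_closedBall_eq_rotMean {f : E → ℝ} (hf : Continuous f) (x : E) (R : ℝ) :
    ∫ z in closedBall x R, f z = ∫ z in closedBall (0 : E) R, rotMean f x z := by
  unfold rotMean
  rw [integral_integral_swap]
  · have key : ∀ T : unitary (E →L[ℝ] E),
        ∫ z in closedBall (0 : E) R, f (x + (T : E →L[ℝ] E) z) = ∫ z in closedBall x R, f z := by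
      intro T
      have h1 := (LinearIsometryEquiv.measurePreserving
        (Unitary.linearIsometryEquiv T)).setIntegral_preimage_emb
        (Unitary.linearIsometryEquiv T).toHomeomorph.measurableEmbedding
        (fun z => f (x + z)) (closedBall 0 R)
      have h2 := (measurePreserving_add_left (volume : Measure E) x).setIntegral_preimage_emb
        (measurableEmbedding_addLeft x) f (closedBall x R)
      rw [LinearIsometryEquiv.preimage_closedBall, map_zero] at h1
      rw [preimage_add_closedBall, sub_self] at h2
      exact h1.trans h2
    simp_rw [key]
    simp
  · rw [← Measure.restrict_univ (μ := rotHaar E), Measure.prod_restrict]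
    refine ContinuousOn.integrableOn_compact ((isCompact_closedBall _ _).prod isCompact_univ) ?_
    unfold Function.uncurry
    fun_prop

lemma integrableOn_closedBall {f : E → ℝ} (hf : Continuous f) (x : E) (R : ℝ) :
    IntegrableOn f (closedBall x R) :=
  hf.continuousOn.integrableOn_compact (isCompact_closedBall _ _)

lemma IsSubMean.le_setIntegral {u : E → ℝ} (hu : IsSubMean u) (x : E) (R : ℝ) :
    volume.real (closedBall (0 : E) R) * u x ≤ ∫ z in closedBall x R, u z := by
  rw [setIntegral_closedBall_eq_rotMean hu.continuous, ← smul_eq_mul, ← setIntegral_const]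
  exact setIntegral_mono (integrableOn_closedBall continuous_const 0 R)
    (integrableOn_closedBall (continuous_rotMean hu.continuous x) 0 R) (hu.le_rotMean x)

lemma IsSubMean.setIntegral_le {u : E → ℝ} (hu : IsSubMean u) (y : E) :
    ∫ z in closedBall 0 ‖y‖, u z ≤
      volume.real (closedBall (0 : E) ‖y‖) * rotMean u 0 y := by
  rw [setIntegral_closedBall_eq_rotMean hu.continuous, ← smul_eq_mul, ← setIntegral_const]
  refine setIntegral_mono_on (integrableOn_closedBall (continuous_rotMean hu.continuous 0) 0 _)
    (integrableOn_closedBall continuous_const 0 _) measurableSet_closedBall fun z hz => ?_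
  exact hu.rotMean_mono (by simpa using hz)

lemma setIntegral_closedBall_mono {u : E → ℝ} (hc : Continuous u) (h0 : ∀ x, 0 ≤ u x) {x y : E}
    {R R' : ℝ} (h : R + dist x y ≤ R') :
    ∫ z in closedBall x R, u z ≤ ∫ z in closedBall y R', u z :=
  setIntegral_mono_set (integrableOn_closedBall hc _ _) (.of_forall h0)
    (closedBall_subset_closedBall' h).eventuallyLE

lemma volume_real_closedBall_zero (R : ℝ) (hR : 0 ≤ R) :
    volume.real (closedBall (0 : E) R) =
      R ^ Module.finrank ℝ E * volume.real (closedBall (0 : E) 1) := by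
  simp only [Measure.real]
  rw [Measure.addHaar_closedBall' _ _ hR, ENNReal.toReal_mul, ENNReal.toReal_ofReal (by positivity)]

lemma volume_real_closedBall_pos : 0 < volume.real (closedBall (0 : E) 1) :=
  ENNReal.toReal_pos (measure_closedBall_pos _ _ one_pos).ne' measure_closedBall_lt_top.ne

lemma IsSubMean.le_two_pow_mul_rotMean {u : E → ℝ} (hu : IsSubMean u) (h0 : ∀ x, 0 ≤ u x)
    {x y : E} (hy : y ≠ 0) (hxy : 2 * ‖x‖ ≤ ‖y‖) :
    u x ≤ 2 ^ Module.finrank ℝ E * rotMean u 0 y := by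
  have hy' : 0 < ‖y‖ := norm_pos_iff.mpr hy
  have h := (hu.le_setIntegral x (‖y‖ / 2)).trans
    ((setIntegral_closedBall_mono hu.continuous h0 (R' := ‖y‖) (y := 0)
      (by rw [dist_zero_right]; linarith)).trans (hu.setIntegral_le y))
  rw [volume_real_closedBall_zero _ (by positivity), volume_real_closedBall_zero _ hy'.le,
    div_pow] at h
  have hb := volume_real_closedBall_pos (E := E)
  have hc : 0 < ‖y‖ ^ Module.finrank ℝ E / 2 ^ Module.finrank ℝ E *
    volume.real (closedBall (0 : E) 1) := by positivity
  refine le_of_mul_le_mul_left (h.trans_eq ?_) hc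
  field_simp

lemma apply_le_apply_of_isSubMean_of_nonneg {w : E → ℝ} (hw : IsSubMean w)
    (hw' : IsSubMean (-w)) (h0 : ∀ x, 0 ≤ w x) (x y : E) : w x ≤ w y := by
  have hb := volume_real_closedBall_pos (E := E)
  have key : ∀ R : ℝ, 0 < R → w x ≤ (1 + dist x y / R) ^ Module.finrank ℝ E * w y := by
    intro R hR
    have h1 := (hw.le_setIntegral x R).trans 
      (setIntegral_closedBall_mono hw.continuous h0 (le_refl (R + dist x y)))
    have h2 := hw'.le_setIntegral y (R + dist x y)
    simp only [Pi.neg_apply, integral_neg] at h2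
    have hd : 0 ≤ dist x y := dist_nonneg
    rw [volume_real_closedBall_zero _ (by positivity)] at h1 h2
    have h3 : R ^ Module.finrank ℝ E * volume.real (closedBall (0 : E) 1) * w x ≤
      (R + dist x y) ^ Module.finrank ℝ E * volume.real (closedBall (0 : E) 1) * w y := by linarith
    have h4 : R + dist x y = R * (1 + dist x y / R) := by field_simp
    rw [h4, mul_pow] at h3
    refine le_of_mul_le_mul_left (h3.trans_eq ?_) (by positivity :
      0 < R ^ Module.finrank ℝ E * volume.real (closedBall (0 : E) 1))
    ring
  have hlim : Tendsto (fun R : ℝ => (1 + dist x y / R) ^ Module.finrank ℝ E * w y) atTop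
      (𝓝 ((1 + 0) ^ Module.finrank ℝ E * w y)) :=
    ((tendsto_const_nhds.add (tendsto_const_nhds.div_atTop tendsto_id)).pow _).mul_const _
  simpa using ge_of_tendsto hlim ((eventually_gt_atTop 0).mono key)

/-- **Liouville's theorem** for functions with the mean value property. -/
lemma eq_of_isSubMean_of_bddAbove {v : E → ℝ} (hv : IsSubMean v) (hv' : IsSubMean (-v))
    {K : ℝ} (hK : ∀ x, v x ≤ K) (x y : E) : v x = v y := by
  have hw : IsSubMean fun x => K - v x :=
    ⟨continuous_const.sub hv.continuous, fun x y => by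
      have := hv'.le_rotMean x y
      have hc := hv.continuous
      unfold rotMean at this ⊢
      rw [integral_sub (integrable_const _) (integrable_rotHaar (by fun_prop))]
      simp only [Pi.neg_apply, integral_neg] at this
      simp only [integral_const, probReal_univ, one_smul]
      linarith⟩
  have hw' : IsSubMean (-fun x => K - v x) :=
    ⟨(continuous_const.sub hv.continuous).neg, fun x y => by
      have := hv.le_rotMean x y
      have hc := hv.continuous
      unfold rotMean at this ⊢
      simp only [Pi.neg_apply, integral_neg]
      rw [integral_sub (integrable_const _) (integrable_rotHaar (by fun_prop))]
      simp only [integral_const, probReal_univ, one_smul]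
      linarith⟩
  have h := apply_le_apply_of_isSubMean_of_nonneg hw hw' fun x => sub_nonneg.mpr (hK x)
  linarith [h x y, h y x]

/-! ### Rotation invariant measures on spheres -/

lemma eq_smul_map_rotHaar {ν : Measure E} [IsFiniteMeasure ν]
    (hinv : ∀ T : unitary (E →L[ℝ] E), ν.map (T : E →L[ℝ] E) = ν) {y : E}
    (hsupp : ∀ᵐ z ∂ν, ‖z‖ = ‖y‖) :
    ν = ν univ • (rotHaar E).map fun T : unitary (E →L[ℝ] E) => (T : E →L[ℝ] E) y := by
  have hmy : ∀ z : E, Measurable fun T : unitary (E →L[ℝ] E) => (T : E →L[ℝ] E) z := fun z =>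
    (by fun_prop : Continuous fun T : unitary (E →L[ℝ] E) => (T : E →L[ℝ] E) z).measurable
  refine Measure.ext_of_lintegral _ fun f hf => ?_
  have hcont : Continuous fun p : unitary (E →L[ℝ] E) × E => (p.1 : E →L[ℝ] E) p.2 := by fun_prop
  calc ∫⁻ z, f z ∂ν
      = ∫⁻ T : unitary (E →L[ℝ] E), ∫⁻ z, f ((T : E →L[ℝ] E) z) ∂ν ∂rotHaar E := by
        have : ∀ T : unitary (E →L[ℝ] E), ∫⁻ z, f ((T : E →L[ℝ] E) z) ∂ν = ∫⁻ z, f z ∂ν := by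
          intro T
          rw [← lintegral_map hf (by fun_prop), hinv]
        simp [this]
    _ = ∫⁻ z, ∫⁻ T : unitary (E →L[ℝ] E), f ((T : E →L[ℝ] E) z) ∂rotHaar E ∂ν :=
        lintegral_lintegral_swap (hf.comp hcont.measurable).aemeasurable
    _ = ∫⁻ _, ∫⁻ T : unitary (E →L[ℝ] E), f ((T : E →L[ℝ] E) y) ∂rotHaar E ∂ν := by
        refine lintegral_congr_ae (hsupp.mono fun z hz => ?_)
        obtain ⟨S, rfl⟩ := exists_rotation_apply_eq hz.symm
        exact lintegral_mul_right_eq_self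
          (fun T : unitary (E →L[ℝ] E) => f ((T : E →L[ℝ] E) y)) S
    _ = ∫⁻ z, f z ∂(ν univ • (rotHaar E).map fun T : unitary (E →L[ℝ] E) => (T : E →L[ℝ] E) y) := by
        rw [lintegral_const, lintegral_smul_measure, lintegral_map hf (hmy y), smul_eq_mul,
          mul_comm]

lemma hausdorffMeasure_restrict_sphere_eq {d : ℝ} {y : E}
    (hfin : μH[d] (sphere (0 : E) ‖y‖) ≠ ∞) :
    (μH[d] : Measure E).restrict (sphere 0 ‖y‖) =
      μH[d] (sphere (0 : E) ‖y‖) • (rotHaar E).map fun T : unitary (E →L[ℝ] E) => (T : E →L[ℝ] E) y := by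
  have : IsFiniteMeasure ((μH[d] : Measure E).restrict (sphere 0 ‖y‖)) :=
    ⟨by simpa using hfin.lt_top⟩
  have h := eq_smul_map_rotHaar (ν := (μH[d] : Measure E).restrict (sphere 0 ‖y‖)) (y := y)
    (fun T => ?_) ?_
  · simpa using h
  · have hT := (IsometryEquiv.measurePreserving_hausdorffMeasure
      (Unitary.linearIsometryEquiv T).toIsometryEquiv d).restrict_preimage
      (isClosed_sphere (x := (0 : E)) (ε := ‖y‖)).measurableSet
    have hpre : (Unitary.linearIsometryEquiv T).toIsometryEquiv ⁻¹' sphere (0 : E) ‖y‖ =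
        sphere 0 ‖y‖ := by
      ext z
      simp
    rw [hpre] at hT
    exact hT.map_eq
  · filter_upwards [ae_restrict_mem (isClosed_sphere (x := (0 : E))).measurableSet] with z hz
    simpa using hz

omit [FiniteDimensional ℝ E] in
lemma hausdorffMeasure_sphere (n : ℕ) {t : ℝ} (ht : 0 < t) :
    μH[n] (sphere (0 : E) t) = ENNReal.ofReal (t ^ n) * μH[n] (sphere (0 : E) 1) := by
  have h := Measure.hausdorffMeasure_smul₀ n.cast_nonneg ht.ne' (sphere (0 : E) 1)
  rw [smul_sphere' ht.ne', smul_zero, mul_one, Real.norm_of_nonneg ht.le] at h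
  rw [h, NNReal.rpow_natCast, ENNReal.smul_def, smul_eq_mul, ENNReal.ofReal, ENNReal.coe_inj.mpr]
  ext
  simp [abs_of_pos ht, ht.le]

end Rotations

/-! ### Growth estimates -/

lemma bounded_of_scaling {E : Type*} [NormedAddCommGroup E] {u : E → ℝ} {N δ b C s₀ : ℝ} {q : ℕ}
    (hN : 0 ≤ N) (hδ₀ : 0 ≤ δ) (hδ : δ ≤ 1 / 2) (hb : 1 ≤ b) (hδb : δ * b ^ q ≤ 1 / 2)
    (hs₀ : 0 ≤ s₀) (hgrow : ∀ x, u x ≤ C + ‖x‖ ^ q)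
    (hstep : ∀ s ≥ s₀, ∀ K, (∀ x, ‖x‖ ≤ b * s → u x ≤ K) → ∀ x, ‖x‖ ≤ s → u x ≤ N + δ * K)
    (x : E) : u x ≤ 2 * N := by
  have hiter : ∀ n : ℕ, ∀ s ≥ s₀, ∀ K, (∀ x, ‖x‖ ≤ b ^ n * s → u x ≤ K) →
      ∀ x, ‖x‖ ≤ s → u x ≤ 2 * N + δ ^ n * K := by
    intro n
    induction n with
    | zero =>
      intro s hs K hK x hx
      linarith [hK x (by simpa using hx)]
    | succ n ih =>
      intro s hs K hK x hx
      have hbs : s₀ ≤ b * s := by nlinarith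
      have := hstep s hs (2 * N + δ ^ n * K)
        (ih (b * s) hbs K fun z hz => hK z (hz.trans_eq (by ring))) x hx
      have h2 : δ * (2 * N) ≤ N := by nlinarith
      calc u x ≤ N + δ * (2 * N) + δ ^ (n + 1) * K := by
            rw [pow_succ]; linarith
        _ ≤ _ := by linarith
  set s := max s₀ ‖x‖
  have hs : 0 ≤ s := hs₀.trans (le_max_left _ _)
  have hbound : ∀ n : ℕ, u x ≤ 2 * N + ((1 / 2) ^ n * |C| + (1 / 2) ^ n * s ^ q) := by
    intro n
    have h := hiter n s (le_max_left _ _) (|C| + (b ^ n * s) ^ q) (fun z hz =>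
      (hgrow z).trans (add_le_add (le_abs_self C) (pow_le_pow_left₀ (norm_nonneg _) hz q))) x
      (le_max_right _ _)
    have h1 : δ ^ n ≤ (1 / 2) ^ n := pow_le_pow_left₀ hδ₀ hδ n
    have h2 : (δ * b ^ q) ^ n ≤ (1 / 2) ^ n := pow_le_pow_left₀ (by positivity) hδb n
    have h3 : δ ^ n * (|C| + (b ^ n * s) ^ q) = δ ^ n * |C| + (δ * b ^ q) ^ n * s ^ q := by
      rw [mul_pow δ, mul_pow (b ^ n), ← pow_mul, ← pow_mul, mul_comm n q]; ring
    rw [h3] at h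
    refine h.trans ?_
    gcongr
  have ht := tendsto_pow_atTop_nhds_zero_of_lt_one (r := (1 / 2 : ℝ)) (by norm_num) (by norm_num)
  have hlim : Tendsto (fun n : ℕ => 2 * N + ((1 / 2 : ℝ) ^ n * |C| + (1 / 2) ^ n * s ^ q)) atTop
      (𝓝 (2 * N + (0 * |C| + 0 * s ^ q))) :=
    tendsto_const_nhds.add ((ht.mul_const _).add (ht.mul_const _))
  simpa using ge_of_tendsto' hlim hbound

lemma exists_growth_of_ordR_lt_top {V : Type*} [NormedAddCommGroup V] [ProperSpace V] {v : V → ℝ}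
    (hv : Continuous v) (hord : ordR v < ⊤) :
    ∃ (C : ℝ) (q : ℕ), ∀ x, max (v x) 0 ≤ C + ‖x‖ ^ q := by
  obtain ⟨p, hp, -⟩ := EReal.lt_iff_exists_real_btwn.mp hord
  obtain ⟨q, hq⟩ := exists_nat_ge p
  have hev := eventually_lt_of_limsup_lt hp
  have hev' : ∀ᶠ x in Bornology.cobounded V, max (v x) 0 ≤ ‖x‖ ^ q := by
    filter_upwards [hev, tendsto_norm_cobounded_atTop.eventually (eventually_gt_atTop 1)]
      with x hx hx1
    rw [EReal.coe_lt_coe_iff, div_lt_iff₀ (Real.log_pos hx1)] at hx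
    have h0 : 0 ≤ max (v x) 0 := le_max_right _ _
    have h1 : Real.log (1 + max (v x) 0) ≤ Real.log (‖x‖ ^ q) := by
      rw [Real.log_pow]
      exact hx.le.trans (mul_le_mul_of_nonneg_right hq (Real.log_pos hx1).le)
    have := (Real.log_le_log_iff (by positivity) (by positivity)).mp h1
    linarith
  obtain ⟨R, -, hR⟩ := (Metric.hasBasis_cobounded_compl_closedBall (0 : V)).eventually_iff.mp hev'
  obtain ⟨C, hC⟩ := (isCompact_closedBall (0 : V) R).exists_bound_of_continuousOn
    (hv.max continuous_const (g := fun _ => (0 : ℝ))).continuousOn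
  refine ⟨max C 0, q, fun x => ?_⟩
  have hpow : 0 ≤ ‖x‖ ^ q := by positivity
  by_cases hx : x ∈ closedBall (0 : V) R
  · linarith [(le_abs_self _).trans (hC x hx), le_max_left C 0]
  · linarith [hR hx, le_max_right C 0]

/-! ### The main theorem -/

lemma hausdorffMeasure_sphere_ne_top {m : ℕ} (hm : 1 ≤ m) (hs : sphereArea m ≠ 0) {t : ℝ}
    (ht : 0 < t) : μH[(m : ℝ) - 1] (sphere (0 : Em m) t) ≠ ∞ := by
  have h1 : μH[(m : ℝ) - 1] (sphere (0 : Em m) 1) ≠ ∞ := fun h => hs (by simp [sphereArea, h])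
  have hcast : (m : ℝ) - 1 = ((m - 1 : ℕ) : ℝ) := by push_cast [hm]; ring
  rw [hcast] at h1 ⊢
  rw [hausdorffMeasure_sphere _ ht]
  exact ENNReal.mul_ne_top ENNReal.ofReal_ne_top h1

lemma rSMean_eq_rotMean {m : ℕ} (hm : 1 ≤ m) (hs : sphereArea m ≠ 0) {v : Em m → ℝ}
    (hv : Continuous v) (x y : Em m) (hy : y ≠ 0) : rSMean m v x ‖y‖ = rotMean v x y := by
  have hy' : 0 < ‖y‖ := norm_pos_iff.mpr hy
  have hfin := hausdorffMeasure_sphere_ne_top hm hs hy'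
  have hcast : (m : ℝ) - 1 = ((m - 1 : ℕ) : ℝ) := by push_cast [hm]; ring
  have htrans := ((IsometryEquiv.measurePreserving_hausdorffMeasure
    (IsometryEquiv.addLeft x) ((m : ℝ) - 1)).setIntegral_preimage_emb
    (measurableEmbedding_addLeft x) v (sphere x ‖y‖))
  have hpre : IsometryEquiv.addLeft x ⁻¹' sphere x ‖y‖ = sphere (0 : Em m) ‖y‖ := by
    ext z
    simp
  rw [hpre] at htrans
  have hcont : Continuous fun T : unitary (Em m →L[ℝ] Em m) => (T : Em m →L[ℝ] Em m) y := by
    fun_prop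
  have hmean : ∫ z in sphere (0 : Em m) ‖y‖, v (x + z) ∂μH[(m : ℝ) - 1] =
      (μH[(m : ℝ) - 1] (sphere (0 : Em m) ‖y‖)).toReal * rotMean v x y := by
    rw [hausdorffMeasure_restrict_sphere_eq hfin, integral_smul_measure,
      integral_map hcont.measurable.aemeasurable
        (by fun_prop : Continuous fun z => v (x + z)).aestronglyMeasurable]
    rfl
  have harea : (μH[(m : ℝ) - 1] (sphere (0 : Em m) ‖y‖)).toReal =
      ‖y‖ ^ (m - 1) * sphereArea m := by
    unfold sphereArea
    rw [hcast, hausdorffMeasure_sphere _ hy', ENNReal.toReal_mul,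
      ENNReal.toReal_ofReal (by positivity)]
  have htrans' : ∫ z in sphere x ‖y‖, v z ∂μH[(m : ℝ) - 1] =
    ∫ z in sphere (0 : Em m) ‖y‖, v (x + z) ∂μH[(m : ℝ) - 1] := htrans.symm
  unfold rSMean
  rw [htrans', hmean, harea]
  field_simp

lemma HarmonicOn.eq_rotMean {m : ℕ} (hm : 1 ≤ m) (hs : sphereArea m ≠ 0) {v : Em m → ℝ}
    (hv : HarmonicOn m v univ) (x y : Em m) : v x = rotMean v x y := by
  rcases eq_or_ne y 0 with rfl | hy
  · simp [rotMean]
  · rw [← rSMean_eq_rotMean hm hs (continuousOn_univ.mp hv.1) x y hy]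
    exact hv.2 x (mem_univ _) _ (norm_pos_iff.mpr hy) (subset_univ _)

lemma tendsto_rotHaar_of_tendsto_hausdorffMeasure {m : ℕ} (hm : 1 ≤ m) (hs : sphereArea m ≠ 0)
    {E : Set (Em m)} {y : ℕ → Em m} (hy : ∀ k, y k ≠ 0)
    (hmeas : ∀ k, MeasurableSet (E ∩ sphere (0 : Em m) ‖y k‖))
    (hsmall : Tendsto
      (fun k => μH[(m : ℝ) - 1] (E ∩ sphere (0 : Em m) ‖y k‖) /
        ENNReal.ofReal (‖y k‖ ^ (m - 1))) atTop (𝓝 0)) :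
    Tendsto (fun k => (rotHaar (Em m)).real {T | (T : Em m →L[ℝ] Em m) (y k) ∈ E}) atTop
      (𝓝 0) := by
  have hcast : (m : ℝ) - 1 = ((m - 1 : ℕ) : ℝ) := by push_cast [hm]; ring
  set A := μH[(m : ℝ) - 1] (sphere (0 : Em m) 1) with hA
  have hA0 : A ≠ 0 := fun h => hs (by simp [sphereArea, ← hA, h])
  have hAtop : A ≠ ∞ := hausdorffMeasure_sphere_ne_top hm hs one_pos
  have heq : ∀ k, rotHaar (Em m) {T : unitary (Em m →L[ℝ] Em m) | (T : Em m →L[ℝ] Em m) (y k) ∈ E} =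
      μH[(m : ℝ) - 1] (E ∩ sphere (0 : Em m) ‖y k‖) / ENNReal.ofReal (‖y k‖ ^ (m - 1)) / A := by
    intro k
    have hk : 0 < ‖y k‖ := norm_pos_iff.mpr (hy k)
    have hcont : Continuous fun T : unitary (Em m →L[ℝ] Em m) =>
      (T : Em m →L[ℝ] Em m) (y k) := by fun_prop
    have h := congrArg (fun μ => μ (E ∩ sphere (0 : Em m) ‖y k‖))
      (hausdorffMeasure_restrict_sphere_eq (hausdorffMeasure_sphere_ne_top hm hs hk))
    have hset : (fun T : unitary (Em m →L[ℝ] Em m) => (T : Em m →L[ℝ] Em m) (y k)) ⁻¹'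
        (E ∩ sphere (0 : Em m) ‖y k‖) =
          {T : unitary (Em m →L[ℝ] Em m) | (T : Em m →L[ℝ] Em m) (y k) ∈ E} := by
      ext T
      simp [Unitary.norm_map]
    have harea : μH[(m : ℝ) - 1] (sphere (0 : Em m) ‖y k‖) =
        ENNReal.ofReal (‖y k‖ ^ (m - 1)) * A := by
      rw [hA, hcast, hausdorffMeasure_sphere _ hk]
    simp only [Measure.smul_apply, smul_eq_mul] at h
    rw [Measure.restrict_apply (hmeas k), inter_assoc, inter_self,
      Measure.map_apply hcont.measurable (hmeas k), hset, harea] at h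
    have hr0 : ENNReal.ofReal (‖y k‖ ^ (m - 1)) ≠ 0 := by
      exact (ENNReal.ofReal_pos.mpr (pow_pos hk _)).ne'
    rw [h, mul_assoc, mul_comm, ENNReal.mul_div_cancel_right hr0 ENNReal.ofReal_ne_top, mul_comm,
      ENNReal.mul_div_cancel_right hA0 hAtop]
  have hlim := ENNReal.Tendsto.div_const hsmall (b := A) (.inr hA0)
  rw [ENNReal.zero_div] at hlim
  simp_rw [← heq] at hlim
  simpa using! (ENNReal.tendsto_toReal ENNReal.zero_ne_top).comp hlim

lemma rotMean_le_add_mul {E : Type*} [NormedAddCommGroup E] [InnerProductSpace ℝ E]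
    [FiniteDimensional ℝ E] {u : E → ℝ} (hc : Continuous u) {A : Set E} {M K : ℝ} {y : E}
    (hA : MeasurableSet {T : unitary (E →L[ℝ] E) | (T : E →L[ℝ] E) y ∈ A})
    (hM : 0 ≤ M) (hout : ∀ x ∉ A, u x ≤ M) (hin : ∀ x, ‖x‖ = ‖y‖ → u x ≤ K) :
    rotMean u 0 y ≤ M + (rotHaar E).real {T | (T : E →L[ℝ] E) y ∈ A} * K := by
  set B := {T : unitary (E →L[ℝ] E) | (T : E →L[ℝ] E) y ∈ A}
  have hint : Integrable (B.indicator fun _ => K) (rotHaar E) :=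
    (integrable_const K).indicator hA
  have hB : ∫ T, B.indicator (fun _ => K) T ∂rotHaar E = (rotHaar E).real B * K := by
    rw [integral_indicator hA, setIntegral_const, smul_eq_mul]
  calc rotMean u 0 y ≤ ∫ T, (M + B.indicator (fun _ => K) T) ∂rotHaar E := by
        refine integral_mono (integrable_rotHaar (by fun_prop))
          ((integrable_const M).add hint) fun T => ?_
        by_cases hT : T ∈ B
        · simp only [indicator_of_mem hT, zero_add]
          linarith [hin _ (Unitary.norm_map T y)]
        · simp only [indicator_of_notMem hT, zero_add, add_zero]
          exact hout _ hT
    _ = _ := by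
        rw [integral_add (integrable_const M) hint, hB]
        simp

lemma exists_index_between {r : ℕ → ℝ} (hrmono : Monotone r) (hrunb : Tendsto r atTop atTop)
    {a : ℝ} {k₀ : ℕ} (hratio : ∀ k ≥ k₀, r (k + 1) ≤ a * r k) (ha : 0 ≤ a) {s : ℝ}
    (hs : r k₀ < s) : ∃ k ≥ k₀, s ≤ r k ∧ r k ≤ a * s := by
  classical
  have hex : ∃ k, s ≤ r k := (hrunb.eventually_ge_atTop s).exists
  have hk := Nat.find_spec hex
  have hlt : k₀ < Nat.find hex := by
    by_contra! h
    exact absurd (hk.trans (hrmono h)) (not_le.mpr hs)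
  obtain ⟨j, hj⟩ : ∃ j, Nat.find hex = j + 1 := Nat.exists_eq_succ_of_ne_zero (by omega)
  have hjs : r j < s := not_le.mp (Nat.find_min hex (by omega))
  refine ⟨Nat.find hex, hlt.le, hk, ?_⟩
  rw [hj]
  exact (hratio j (by omega)).trans (mul_le_mul_of_nonneg_left hjs.le ha)

/-- A harmonic function of finite order on `ℝᵐ`, bounded above outside a set `E` that is
asymptotically small on a commensurable sequence of spheres, is constant. -/
theorem harmonic_finite_order_constant (m : ℕ) (hm : 1 ≤ m)
    (E : Set (Em m)) (r : ℕ → ℝ)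
    (hrpos : ∀ k, 0 < r k) (hrmono : Monotone r)
    (hrunb : Tendsto r atTop atTop)
    (hratio : Filter.limsup (fun k => ((r (k + 1) / r k : ℝ) : EReal)) atTop < ⊤)
    (hmeas : ∀ k, MeasurableSet (E ∩ Metric.sphere (0 : Em m) (r k)))
    (hsmall : Tendsto
      (fun k => μH[(m : ℝ) - 1] (E ∩ Metric.sphere (0 : Em m) (r k)) /
        ENNReal.ofReal ((r k) ^ (m - 1))) atTop (𝓝 0))
    (v : Em m → ℝ)
    (hharm : HarmonicOn m v Set.univ)
    (hord : ordR v < ⊤)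
    (hbd : ∃ M : ℝ, ∀ x ∉ E, v x ≤ M) :
    ∀ x y : Em m, v x = v y := by
  obtain ⟨M₀, hM₀⟩ := hbd
  by_cases hs : sphereArea m = 0
  · have hzero : ∀ x, v x = 0 := fun x => by
      rw [hharm.2 x (mem_univ _) 1 one_pos (subset_univ _)]
      simp [rSMean, hs]
    simp [hzero]
  have hc : Continuous v := continuousOn_univ.mp hharm.1
  have hmv := hharm.eq_rotMean hm hs
  have hsub : IsSubMean v := ⟨hc, fun x y => (hmv x y).le⟩
  have hsub' : IsSubMean (-v) := ⟨hc.neg, fun x y => by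
    simp only [rotMean, Pi.neg_apply, integral_neg, neg_le_neg_iff]
    exact (hmv x y).ge⟩
  obtain ⟨C, q, hgrow⟩ := exists_growth_of_ordR_lt_top hc hord
  set u : Em m → ℝ := fun x => max (v x) 0 with hu
  have husub : IsSubMean u := hsub.max_zero
  have hu0 : ∀ x, 0 ≤ u x := fun x => le_max_right _ _
  have hout : ∀ x ∉ E, u x ≤ max M₀ 0 := fun x hx => max_le_max_right 0 (hM₀ x hx)
  have hnontriv : Nontrivial (Em m) := by
    have : Nonempty (Fin m) := ⟨⟨0, hm⟩⟩
    infer_instance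
  choose y hy using fun k => exists_norm_eq (Em m) (hrpos k).le
  have hy0 : ∀ k, y k ≠ 0 := fun k => norm_pos_iff.mp ((hy k).symm ▸ hrpos k)
  obtain ⟨a₀, ha₀, -⟩ := EReal.lt_iff_exists_real_btwn.mp hratio
  set a := max a₀ 1
  have ha1 : 1 ≤ a := le_max_right _ _
  have hb1 : 1 ≤ 2 * a := by linarith
  have hratio' : ∀ᶠ k in atTop, r (k + 1) ≤ a * r k := by
    filter_upwards [eventually_lt_of_limsup_lt ha₀] with k hk
    rw [EReal.coe_lt_coe_iff, div_lt_iff₀ (hrpos k)] at hk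
    exact hk.le.trans (mul_le_mul_of_nonneg_right (le_max_left _ _) (hrpos k).le)
  set δ : ℝ := 1 / (2 * (2 * a) ^ q)
  have hbq : 1 ≤ (2 * a) ^ q := one_le_pow₀ hb1
  have hδ0 : 0 < δ := by positivity
  have hδ : δ ≤ 1 / 2 := by
    refine one_div_le_one_div_of_le (by norm_num) ?_
    linarith
  have hδb : δ * (2 * a) ^ q ≤ 1 / 2 := by
    refine le_of_eq ?_
    simp only [δ]
    field_simp
  have htend := tendsto_rotHaar_of_tendsto_hausdorffMeasure (E := E) hm hs hy0
    (by simpa only [hy] using hmeas) (by simpa only [hy] using hsmall)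
  have hε : ∀ᶠ k in atTop,
      (rotHaar (Em m)).real {T | (T : Em m →L[ℝ] Em m) (y k) ∈ E} ≤ δ / 2 ^ m :=
    htend.eventually_le_const (by positivity)
  obtain ⟨k₀, hk₀⟩ := eventually_atTop.mp (hratio'.and hε)
  have hbound : ∀ x, u x ≤ 2 * (2 ^ m * max M₀ 0) := by
    refine bounded_of_scaling (by positivity) hδ0.le hδ hb1 hδb (hrpos k₀).le hgrow ?_
    intro s hs' K hK x hx
    have hspos : 0 < s := (hrpos k₀).trans_le hs'
    obtain ⟨k, hk, hk1, hk2⟩ := exists_index_between hrmono hrunb (fun k hk => (hk₀ k hk).1)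
      (by linarith : 0 ≤ a) (by linarith : r k₀ < 2 * s)
    have hK0 : 0 ≤ K := (hu0 0).trans (hK 0 (by rw [norm_zero]; positivity))
    have hmeasT : MeasurableSet
        {T : unitary (Em m →L[ℝ] Em m) | (T : Em m →L[ℝ] Em m) (y k) ∈ E} := by
      have hcont : Continuous fun T : unitary (Em m →L[ℝ] Em m) =>
        (T : Em m →L[ℝ] Em m) (y k) := by fun_prop
      convert hcont.measurable (hmeas k) using 1
      ext T
      simp [Unitary.norm_map, hy]
    have h1 := husub.le_two_pow_mul_rotMean hu0 (hy0 k) (x := x) (by rw [hy]; linarith)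
    have h2 := rotMean_le_add_mul husub.continuous hmeasT (le_max_right M₀ 0) hout
      fun z hz => hK z (by rw [hz, hy]; linarith)
    rw [finrank_euclideanSpace_fin] at h1
    have h3 := mul_le_mul_of_nonneg_right (hk₀ k hk).2 hK0
    calc u x ≤ 2 ^ m * (max M₀ 0 + δ / 2 ^ m * K) :=
          h1.trans (mul_le_mul_of_nonneg_left (by linarith) (by positivity))
      _ = 2 ^ m * max M₀ 0 + δ * K := by field_simp
  exact eq_of_isSubMean_of_bddAbove hsub hsub' fun x => (le_max_left _ _).trans (hbound x)
end
end
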